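/- Fix d ≥ 2 and k ≥ 1. Let X₁, …, X_n be i.i.d. random points in ℝ^d whose common distribution has a bounded measurable density function f, and let r = r(n) > 0 satisfy n·r^d → 0 as n → ∞. Then there exists a constant D_k > 0, depending only on k, d, and f, such that E[β_k(VR(n,r))] / ( n^{2k+2} · r^{d(2k+1)} ) → D_k as n → ∞. -/

import Mathlib

open MeasureTheory Filter Finset Matrix

noncomputable section

/-- Bernoulli measure on `Bool` with success probability `p` (clamped to `[0,1]`). -/
def bernoulliBool (p : ℝ) : Measure Bool :=
  ENNReal.ofReal (max 0 (min p 1)) • Measure.dirac true +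
    ENNReal.ofReal (1 - max 0 (min p 1)) • Measure.dirac false

instance (p : ℝ) : IsFiniteMeasure (bernoulliBool p) := by
  constructor
  simp only [bernoulliBool, Measure.add_apply, Measure.smul_apply, smul_eq_mul,
    measure_univ, mul_one]
  exact ENNReal.add_lt_top.mpr ⟨ENNReal.ofReal_lt_top, ENNReal.ofReal_lt_top⟩

/-- Index type for potential `d`-dimensional faces on vertex set `Fin n`:
the `(d+1)`-element subsets. -/
abbrev FaceIdx (n d : ℕ) : Type := {s : Finset (Fin n) // s.card = d + 1}

/-- The distribution of the random `d`-complex `Y_d(n,p)`: each potential `d`-face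
gets an independent Bernoulli(`p`) coin. (For `d = 1` this is the Erdős–Rényi model
`G(n,p)`.) -/
def YMeasure (n d : ℕ) (p : ℝ) : Measure (FaceIdx n d → Bool) :=
  Measure.pi fun _ => bernoulliBool p

/-- The random `d`-complex: all faces of dimension `≤ d - 1` (i.e. all subsets of
cardinality `≤ d`, including `∅`, so that degree-0 homology below is reduced
homology), together with the chosen `d`-faces. -/
def Ycomplex (n d : ℕ) (ω : FaceIdx n d → Bool) : Finset (Finset (Fin n)) :=
  Finset.univ.filter fun s => s.card ≤ d ∨ ∃ h : s.card = d + 1, ω ⟨s, h⟩ = true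

/-- The Erdős–Rényi random graph associated to a configuration of edge coins. -/
def graphOf (n : ℕ) (ω : FaceIdx n 1 → Bool) : SimpleGraph (Fin n) where
  Adj i j := i ≠ j ∧ ∃ e : FaceIdx n 1, ω e = true ∧ i ∈ e.1 ∧ j ∈ e.1
  symm := ⟨fun i j ⟨hne, e, he, hi, hj⟩ => ⟨hne.symm, e, he, hj, hi⟩⟩
  loopless := ⟨fun i ⟨hne, _⟩ => hne rfl⟩

instance (n : ℕ) (ω : FaceIdx n 1 → Bool) : DecidableRel (graphOf n ω).Adj :=
  fun i j =>
    inferInstanceAs (Decidable (i ≠ j ∧ ∃ e : FaceIdx n 1, ω e = true ∧ i ∈ e.1 ∧ j ∈ e.1))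

/-- The clique complex of the graph determined by the edge coins `ω`:
faces are vertex sets of complete subgraphs (including `∅` and singletons). -/
def cliqueComplex (n : ℕ) (ω : FaceIdx n 1 → Bool) : Finset (Finset (Fin n)) :=
  Finset.univ.filter fun s => ∀ i ∈ s, ∀ j ∈ s, i ≠ j → (graphOf n ω).Adj i j

/-- The group of simplicial `G`-chains of a complex `K`, in cardinality `c`
(i.e. dimension `c - 1`): functions on the faces of `K` of cardinality `c`. -/
abbrev Chains {V : Type} [Fintype V] [DecidableEq V]
    (K : Finset (Finset V)) (c : ℕ) (G : Type) : Type :=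
  {s : Finset V // s ∈ K ∧ s.card = c} → G

/-- The simplicial boundary map, from chains of cardinality `c+1` to chains of
cardinality `c`, with the usual alternating signs coming from the linear order
on the vertices. -/
def chainBoundary {V : Type} [Fintype V] [DecidableEq V] [LinearOrder V]
    (K : Finset (Finset V)) (c : ℕ) {G : Type} [AddCommGroup G]
    (f : Chains K (c + 1) G) : Chains K c G :=
  fun τ => ∑ v : V,
    if h : v ∉ τ.1 ∧ insert v τ.1 ∈ K then
      ((-1 : ℤ) ^ (τ.1.filter (fun u => u < v)).card) •
        f ⟨insert v τ.1, h.2, by rw [Finset.card_insert_of_notMem h.1, τ.2.2]⟩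
    else 0

/-- Vanishing of the simplicial homology of `K` with coefficients in `G` in
degree `i` (faces of cardinality `i+1`): every cycle is a boundary.
If `∅ ∈ K` this is reduced homology (the boundary map to cardinality-0 chains
is the augmentation); in degrees `i ≥ 1` reduced and unreduced homology agree. -/
def HomologyZero {V : Type} [Fintype V] [DecidableEq V] [LinearOrder V]
    (K : Finset (Finset V)) (i : ℕ) (G : Type) [AddCommGroup G] : Prop :=
  ∀ f : Chains K (i + 1) G, chainBoundary K i f = 0 →
    ∃ g : Chains K (i + 2) G, chainBoundary K (i + 1) g = f

/-- Vanishing of top-dimensional homology `H_d(K,G)`, i.e. the kernel of the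
`d`-th boundary map is zero. -/
def TopHomologyZero {V : Type} [Fintype V] [DecidableEq V] [LinearOrder V]
    (K : Finset (Finset V)) (d : ℕ) (G : Type) [AddCommGroup G] : Prop :=
  ∀ f : Chains K (d + 1) G, chainBoundary K d f = 0 → f = 0

/-- The boundary map on real coefficients, as a linear map. -/
def chainBoundaryLin {V : Type} [Fintype V] [DecidableEq V] [LinearOrder V]
    (K : Finset (Finset V)) (c : ℕ) : Chains K (c + 1) ℝ →ₗ[ℝ] Chains K c ℝ where
  toFun := chainBoundary K c
  map_add' f g := by
    funext τ
    simp only [chainBoundary, Pi.add_apply]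
    rw [← Finset.sum_add_distrib]
    refine Finset.sum_congr rfl fun v _ => ?_
    split
    · simp [smul_add]
    · simp
  map_smul' r f := by
    funext τ
    simp only [chainBoundary, Pi.smul_apply, RingHom.id_apply]
    rw [Finset.smul_sum]
    refine Finset.sum_congr rfl fun v _ => ?_
    split
    · exact smul_comm _ _ _
    · simp

/-- The `k`-th Betti number of `K`: the dimension of the `k`-th real simplicial
homology, i.e. of (kernel of `∂_k`) / (image of `∂_{k+1}`). -/
def bettiNumber {V : Type} [Fintype V] [DecidableEq V] [LinearOrder V]
    (K : Finset (Finset V)) (k : ℕ) : ℕ :=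
  Module.finrank ℝ
    (↥(LinearMap.ker (chainBoundaryLin K k)) ⧸
      (LinearMap.range (chainBoundaryLin K (k + 1))).comap
        (LinearMap.ker (chainBoundaryLin K k)).subtype)

/-- The link of a face `σ` in the complex `K`. -/
def linkSet {V : Type} [Fintype V] [DecidableEq V]
    (K : Finset (Finset V)) (σ : Finset V) : Finset (Finset V) :=
  Finset.univ.filter fun τ => τ ∩ σ = ∅ ∧ τ ∪ σ ∈ K

/-- The graph underlying the link of a face `σ`: its vertices are the vertices
of the link, joined when they span an edge of the link. -/
def linkGraph {V : Type} [Fintype V] [DecidableEq V]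
    (K : Finset (Finset V)) (σ : Finset V) :
    SimpleGraph {v : V // {v} ∈ linkSet K σ} where
  Adj a b := a ≠ b ∧ ({a.1, b.1} : Finset V) ∈ linkSet K σ
  symm := ⟨fun a b ⟨hab, h⟩ => ⟨hab.symm, by rwa [Finset.pair_comm]⟩⟩
  loopless := ⟨fun a ⟨hab, _⟩ => hab rfl⟩

instance {V : Type} [Fintype V] [DecidableEq V] (K : Finset (Finset V)) (σ : Finset V) :
    DecidableRel (linkGraph K σ).Adj :=
  fun a b => inferInstanceAs (Decidable (a ≠ b ∧ ({a.1, b.1} : Finset V) ∈ linkSet K σ))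

/-- The normalized Laplacian `I - D^{-1/2} A D^{-1/2}` of a finite graph. -/
def normalizedLaplacian {W : Type} [Fintype W] [DecidableEq W]
    (H : SimpleGraph W) [DecidableRel H.Adj] : Matrix W W ℝ :=
  Matrix.of fun a b =>
    (if a = b then (1 : ℝ) else 0) -
      (if H.Adj a b then 1 / Real.sqrt ((H.degree a : ℝ) * (H.degree b : ℝ)) else 0)

/-- An elementary `d`-collapse step: remove a free `(d-1)`-face `σ` together with
the unique `d`-face `τ` containing it. -/
def CollapseStep {V : Type} [DecidableEq V] (d : ℕ) (K K' : Finset (Finset V)) : Prop :=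
  ∃ σ τ : Finset V, σ ∈ K ∧ τ ∈ K ∧ τ.card = d + 1 ∧ σ ⊆ τ ∧ σ.card = d ∧
    (∀ ρ ∈ K, σ ⊆ ρ → ρ.card = d + 1 → ρ = τ) ∧ K' = K \ {σ, τ}

/-- `K` is `d`-collapsible if some finite sequence of elementary collapses reduces it
to a complex of dimension at most `d-1`. -/
def IsDCollapsible {V : Type} [DecidableEq V] (d : ℕ) (K : Finset (Finset V)) : Prop :=
  ∃ K' : Finset (Finset V),
    Relation.ReflTransGen (CollapseStep d) K K' ∧ ∀ s ∈ K', s.card ≤ d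

/-- The geometric realization of a complex on vertex set `Fin n`, inside `ℝ^n`:
the union over the faces of the convex hulls of the corresponding standard
basis vectors. -/
def geomReal (n : ℕ) (K : Finset (Finset (Fin n))) : Set (Fin n → ℝ) :=
  ⋃ σ ∈ K, convexHull ℝ ((fun i => (Pi.single i 1 : Fin n → ℝ)) '' ↑σ)

/-- The boundary of the simplex on the vertex set `τ`, as a chain of cardinality
`c` (to be used with `τ.card = c + 1`): the alternating sum of the `c`-element
subsets of `τ`. -/
def simplexBoundaryChain {V : Type} [Fintype V] [DecidableEq V] [LinearOrder V]
    (K : Finset (Finset V)) (c : ℕ) (τ : Finset V) : Chains K c ℝ :=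
  fun σ => ∑ v ∈ τ,
    if σ.1 = τ.erase v then ((-1 : ℝ) ^ (τ.filter (fun u => u < v)).card) else 0

/-- Index type for the multiparameter model: all potential faces of dimension `≥ 1`. -/
abbrev MultiIdx (n : ℕ) : Type := {s : Finset (Fin n) // 2 ≤ s.card}

/-- The distribution of the multiparameter random complex `X(n; p₁, p₂, …)`:
a potential face of cardinality `i+1` gets an independent Bernoulli(`p i`) coin. -/
def multiMeasure (n : ℕ) (p : ℕ → ℝ) : Measure (MultiIdx n → Bool) :=
  Measure.pi fun t => bernoulliBool (p (t.1.card - 1))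

/-- The multiparameter random complex: a set `s` is a face iff every subset of `s`
of dimension `≥ 1` has its coin turned on (this is exactly the
inductive-by-dimension construction: a face is present iff its coin is on and all
of its boundary faces are present). -/
def multiComplex (n : ℕ) (ω : MultiIdx n → Bool) : Finset (Finset (Fin n)) :=
  Finset.univ.filter fun s => ∀ t : MultiIdx n, t.1 ⊆ s → ω t = true

/-- The Vietoris–Rips complex of the points `pts` at scale `r`. -/
def VRcomplex (n d : ℕ) (pts : Fin n → EuclideanSpace ℝ (Fin d)) (r : ℝ) :
    Finset (Finset (Fin n)) :=
  Finset.univ.filter fun s => ∀ i ∈ s, ∀ j ∈ s, dist (pts i) (pts j) ≤ r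

end
open MeasureTheory Filter Finset Matrix
noncomputable section

section VRHom
set_option linter.unusedSectionVars false
set_option linter.unusedSimpArgs false
variable {V : Type} [Fintype V] [DecidableEq V] [LinearOrder V]

def sg (v : V) (τ : Finset V) : ℝ := (-1 : ℝ) ^ (τ.filter (fun u => u < v)).card

lemma sg_sq (v : V) (τ : Finset V) : sg v τ * sg v τ = 1 := by
  unfold sg; rw [← mul_pow]; simp

lemma sg_ne (v : V) (τ : Finset V) : sg v τ ≠ 0 := by
  intro h; have := sg_sq v τ; rw [h] at this; simp at this

lemma sg_insert (u v : V) (τ : Finset V) (h : v ∉ τ) :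
    sg u (insert v τ) = (if v < u then -1 else 1) * sg u τ := by
  unfold sg
  rw [Finset.filter_insert]
  split_ifs with h1
  · rw [Finset.card_insert_of_notMem (by simp [h]), pow_succ]; ring
  · simp

lemma sg_swap (u v : V) (τ : Finset V) (hu : u ∉ τ) (hv : v ∉ τ) (huv : u ≠ v) :
    sg u (insert v τ) * sg v (insert u τ) = - (sg v τ * sg u τ) := by
  rw [sg_insert _ _ _ hv, sg_insert _ _ _ hu]
  rcases lt_or_gt_of_ne huv with h | h
  · simp [h, h.le, not_lt.mpr h.le]; ring
  · simp [h, not_lt.mpr h.le]; ring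

def bd : (Finset V → ℝ) →ₗ[ℝ] (Finset V → ℝ) where
  toFun F τ := ∑ v : V, if v ∉ τ then sg v τ * F (insert v τ) else 0
  map_add' F G := by
    funext τ
    simp only [Pi.add_apply]
    rw [← Finset.sum_add_distrib]
    refine Finset.sum_congr rfl fun v _ => ?_
    split_ifs <;> ring
  map_smul' r F := by
    funext τ
    simp only [Pi.smul_apply, RingHom.id_apply, smul_eq_mul]
    rw [Finset.mul_sum]
    refine Finset.sum_congr rfl fun v _ => ?_
    split_ifs <;> ring

lemma bd_apply (F : Finset V → ℝ) (τ : Finset V) :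
    bd F τ = ∑ v : V, if v ∉ τ then sg v τ * F (insert v τ) else 0 := rfl

def cn (v : V) (F : Finset V → ℝ) (σ : Finset V) : ℝ :=
  if v ∈ σ then sg v (σ.erase v) * F (σ.erase v) else 0

lemma bd_cn (v : V) (F : Finset V → ℝ) (τ : Finset V) :
    bd (cn v F) τ = F τ - cn v (bd F) τ := by
  by_cases hv : v ∈ τ
  · obtain ⟨ρ, hρ, rfl⟩ : ∃ ρ, v ∉ ρ ∧ insert v ρ = τ :=
      ⟨τ.erase v, by simp, Finset.insert_erase hv⟩
    have e1 : cn v (bd F) (insert v ρ) = sg v ρ * bd F ρ := by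
      simp [cn, Finset.erase_insert hρ]
    rw [e1, bd_apply, bd_apply, Finset.mul_sum]
    rw [← Finset.add_sum_erase _ _ (Finset.mem_univ v),
      ← Finset.add_sum_erase univ (fun u => sg v ρ * _) (Finset.mem_univ v)]
    have e2 : sg v ρ * (if v ∉ ρ then sg v ρ * F (insert v ρ) else 0) = F (insert v ρ) := by
      rw [if_pos hρ, ← mul_assoc, sg_sq, one_mul]
    rw [e2]
    have : ∀ u ∈ univ.erase v, (if u ∉ insert v ρ then
        sg u (insert v ρ) * cn v F (insert u (insert v ρ)) else 0) =
        - (sg v ρ * (if u ∉ ρ then sg u ρ * F (insert u ρ) else 0)) := by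
      intro u hu
      have huv : u ≠ v := by simpa using hu
      by_cases hu' : u ∈ ρ
      · simp [hu']
      · rw [if_pos (by simp [hu', huv]), if_pos hu']
        have e3 : (insert u (insert v ρ)).erase v = insert u ρ := by
          rw [Finset.insert_comm, Finset.erase_insert]; simp [hρ, huv.symm]
        simp only [cn, e3]
        rw [if_pos (by simp), ← mul_assoc, sg_swap u v ρ hu' hρ huv]; ring
    rw [Finset.sum_congr rfl this, Finset.sum_neg_distrib]
    simp
  · have e1 : cn v (bd F) τ = 0 := by simp [cn, hv]
    rw [e1, bd_apply, Finset.sum_eq_single v]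
    · simp [hv, cn, Finset.erase_insert hv, ← mul_assoc, sg_sq]
    · intro u _ huv
      simp [cn, hv, huv.symm]
    · simp

/-- support condition -/
def Sup (A : V → V → Prop) (S : Finset V) (c : ℕ) (F : Finset V → ℝ) : Prop :=
  ∀ σ, F σ ≠ 0 → σ ⊆ S ∧ σ.card = c ∧ ∀ i ∈ σ, ∀ j ∈ σ, A i j

def CP (A : V → V → Prop) (c : ℕ) (S : Finset V) : Prop :=
  S.card = 2 * c ∧ ∀ v ∈ S, ∃ w ∈ S, ¬ A v w ∧ ∀ u ∈ S, ¬ A v u → u = w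

lemma Sup.mono {A : V → V → Prop} {S T : Finset V} {c : ℕ} {F : Finset V → ℝ}
    (h : Sup A S c F) (hST : S ⊆ T) : Sup A T c F :=
  fun σ hσ => ⟨(h σ hσ).1.trans hST, (h σ hσ).2⟩

lemma Sup.add {A : V → V → Prop} {S : Finset V} {c : ℕ} {F G : Finset V → ℝ}
    (h : Sup A S c F) (h' : Sup A S c G) : Sup A S c (F + G) := by
  intro σ hσ
  by_cases hF : F σ = 0
  · by_cases hG : G σ = 0
    · simp [hF, hG] at hσ
    · exact h' σ hG
  · exact h σ hF

lemma Sup.neg {A : V → V → Prop} {S : Finset V} {c : ℕ} {F : Finset V → ℝ}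
    (h : Sup A S c F) : Sup A S c (-F) := by
  intro σ hσ
  exact h σ (by simpa using hσ)

lemma Sup.sub {A : V → V → Prop} {S : Finset V} {c : ℕ} {F G : Finset V → ℝ}
    (h : Sup A S c F) (h' : Sup A S c G) : Sup A S c (F - G) := by
  rw [sub_eq_add_neg]; exact h.add h'.neg

lemma Sup.zero {A : V → V → Prop} {S : Finset V} {c : ℕ} : Sup A S c (0 : Finset V → ℝ) := by
  intro σ hσ; simp at hσ

lemma Sup.cn {A : V → V → Prop} (hr : ∀ i, A i i) (hs : ∀ i j, A i j → A j i)
    {S T : Finset V} {c : ℕ} {F : Finset V → ℝ} {v : V}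
    (h : Sup A T c F) (hT : ∀ u ∈ T, A v u ∧ u ∈ S) (hv : v ∈ S) :
    Sup A S (c + 1) (cn v F) := by
  intro σ hσ
  unfold _root_.cn at hσ
  split_ifs at hσ with hvσ
  · obtain ⟨h1, h2, h3⟩ := h _ (right_ne_zero_of_mul hσ)
    refine ⟨?_, ?_, ?_⟩
    · intro u hu
      by_cases huv : u = v
      · rwa [huv]
      · exact (hT u (h1 (Finset.mem_erase.2 ⟨huv, hu⟩))).2
    · rw [← h2, Finset.card_erase_add_one hvσ]
    · intro i hi j hj
      by_cases hiv : i = v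
      · by_cases hjv : j = v
        · rw [hiv, hjv]; exact hr v
        · rw [hiv]; exact (hT j (h1 (Finset.mem_erase.2 ⟨hjv, hj⟩))).1
      · by_cases hjv : j = v
        · rw [hjv]; exact hs _ _ (hT i (h1 (Finset.mem_erase.2 ⟨hiv, hi⟩))).1
        · exact h3 i (Finset.mem_erase.2 ⟨hiv, hi⟩) j (Finset.mem_erase.2 ⟨hjv, hj⟩)
  · exact absurd rfl hσ

lemma cyc_step {A : V → V → Prop} (hr : ∀ i, A i i) (hs : ∀ i j, A i j → A j i)
    {S N : Finset V} {c : ℕ} {f : Finset V → ℝ} {v : V} (hv : v ∈ S)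
    (hN : ∀ u, u ∈ N ↔ u ∈ S ∧ A v u ∧ u ≠ v)
    (hf : Sup A S (c + 1) f) (hbd : bd f = 0)
    (hlink : ∀ g : Finset V → ℝ, Sup A N c g → bd g = 0 →
      (∀ τ, v ∉ τ → f (insert v τ) = 0 → g τ = 0) → ∃ e, Sup A N (c + 1) e ∧ bd e = g)
    (hdel : ∀ g : Finset V → ℝ, Sup A (S.erase v) (c + 1) g → bd g = 0 →
      ∃ e, Sup A (S.erase v) (c + 1 + 1) e ∧ bd e = g) :
    ∃ e, Sup A S (c + 1 + 1) e ∧ bd e = f := by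
  set g : Finset V → ℝ := fun τ => if v ∈ τ then 0 else sg v τ * f (insert v τ) with hg
  set h : Finset V → ℝ := fun σ => if v ∈ σ then 0 else f σ with hh
  have hdec : f = cn v g + h := by
    funext σ
    by_cases hvσ : v ∈ σ
    · simp [cn, hg, hh, hvσ, Finset.insert_erase hvσ, ← mul_assoc, sg_sq]
    · simp [cn, hh, hvσ]
  have hbdh : ∀ σ, v ∈ σ → bd h σ = 0 := by
    intro σ hσ
    rw [bd_apply]
    refine Finset.sum_eq_zero fun u _ => ?_
    simp [hh, hσ]
  have hbdg : bd g = 0 := by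
    funext τ
    by_cases hvτ : v ∈ τ
    · rw [bd_apply]
      refine Finset.sum_eq_zero fun u _ => ?_
      simp [hg, hvτ]
    · have h1 : bd f (insert v τ) = 0 := by rw [hbd]; rfl
      rw [hdec, map_add, Pi.add_apply, bd_cn, hbdh _ (by simp)] at h1
      have h4 : g (insert v τ) = 0 := by simp [hg]
      have h5 : cn v (bd g) (insert v τ) = sg v τ * bd g τ := by
        simp [cn, Finset.erase_insert hvτ]
      rw [h4, h5] at h1
      have h2 : sg v τ * bd g τ = 0 := by linarith
      rcases mul_eq_zero.1 h2 with h3 | h3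
      · exact absurd h3 (sg_ne _ _)
      · exact h3
  have hgS : Sup A N c g := by
    intro τ hτ
    simp only [hg] at hτ
    split_ifs at hτ with hvτ
    · exact absurd rfl hτ
    · obtain ⟨h1, h2, h3⟩ := hf _ (right_ne_zero_of_mul hτ)
      refine ⟨?_, ?_, ?_⟩
      · intro u hu
        rw [hN]
        refine ⟨h1 (Finset.mem_insert_of_mem hu), h3 v (by simp) u (by simp [hu]), ?_⟩
        rintro rfl; exact hvτ hu
      · rw [Finset.card_insert_of_notMem hvτ] at h2; omega
      · intro i hi j hj
        exact h3 i (by simp [hi]) j (by simp [hj])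
  have hhS : Sup A (S.erase v) (c + 1) h := by
    intro σ hσ
    simp only [hh] at hσ
    split_ifs at hσ with hvσ
    · exact absurd rfl hσ
    · obtain ⟨h1, h2, h3⟩ := hf _ hσ
      refine ⟨?_, h2, h3⟩
      intro u hu
      refine Finset.mem_erase.2 ⟨?_, h1 hu⟩
      rintro rfl; exact hvσ hu
  obtain ⟨e, he, hbe⟩ := hlink g hgS hbdg (by
    intro τ hτ h0; simp [hg, h0])
  have hNS : N ⊆ S.erase v := by
    intro u hu; rw [hN] at hu; exact Finset.mem_erase.2 ⟨hu.2.2, hu.1⟩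
  have hce : Sup A S (c + 1 + 1) (cn v e) :=
    he.cn hr hs (fun u hu => ⟨((hN u).1 hu).2.1, ((hN u).1 hu).1⟩) hv
  have hbce : bd (cn v e) = e - cn v g := by
    funext τ; rw [bd_cn, hbe]; rfl
  have hbf' : h + e = f + bd (cn v e) := by
    rw [hbce, hdec]; abel
  have hbdbd : bd (h + e) = 0 := by
    have h2 : bd h = - g := by
      have : bd (cn v g) = g := by
        funext τ; rw [bd_cn, hbdg]; simp [cn]
      have h3 := hbd
      rw [hdec, map_add, this] at h3
      exact (neg_eq_of_add_eq_zero_right h3).symm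
    rw [map_add, h2, hbe]; simp
  obtain ⟨e', he', hbe'⟩ := hdel (h + e) (hhS.add (he.mono hNS)) hbdbd
  refine ⟨e' - cn v e, (he'.mono (Finset.erase_subset _ _)).sub hce, ?_⟩
  rw [map_sub, hbe', hbf']; abel

theorem cyc_bd {A : V → V → Prop} (hr : ∀ i, A i i) (hs : ∀ i j, A i j → A j i) :
    ∀ (c : ℕ) (S : Finset V), S.card ≤ 2 * c → ∃ σ : Finset V, ∀ f : Finset V → ℝ,
      Sup A S c f → bd f = 0 → (CP A c S → f σ = 0) → ∃ e, Sup A S (c + 1) e ∧ bd e = f := by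
  classical
  intro c
  induction c with
  | zero =>
    intro S hS
    have hS0 : S = ∅ := by simpa using hS
    subst hS0
    refine ⟨∅, fun f hf _ h0 => ⟨0, Sup.zero, ?_⟩⟩
    have h1 := h0 ⟨by simp, by simp⟩
    rw [map_zero]
    funext σ
    by_contra hne
    have h2 := (hf σ (fun h => hne (by simp [h]))).2.1
    rw [Finset.card_eq_zero] at h2
    rw [h2, h1] at hne
    exact hne rfl
  | succ c ih =>
    intro S
    induction S using Finset.strongInduction with
    | H S ihS =>
    intro hS
    rcases S.eq_empty_or_nonempty with rfl | ⟨v0, hv0⟩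
    · refine ⟨∅, fun f hf _ _ => ⟨0, Sup.zero, ?_⟩⟩
      rw [map_zero]
      funext σ
      by_contra hne
      obtain ⟨h1, h2, _⟩ := (hf σ (fun h => hne (by simp [h])))
      rw [Finset.subset_empty.1 h1] at h2
      simp at h2
    by_cases hcone : ∃ v ∈ S, ∀ u ∈ S, A v u
    · obtain ⟨v, hv, hvu⟩ := hcone
      refine ⟨∅, fun f hf hbd _ => ⟨cn v f, hf.cn hr hs (fun u hu => ⟨hvu u hu, hu⟩) hv, ?_⟩⟩
      funext τ; rw [bd_cn, hbd]; simp [cn]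
    push Not at hcone
    set N : V → Finset V := fun v => (S.filter (fun u => A v u)).erase v with hNdef
    have hN : ∀ v u, u ∈ N v ↔ u ∈ S ∧ A v u ∧ u ≠ v := by
      intro v u; simp [hNdef]; tauto
    have hcardN : ∀ v ∈ S, (N v).card + 1 + (S.filter (fun u => ¬ A v u)).card = S.card := by
      intro v hv
      rw [hNdef]; dsimp only
      rw [Finset.card_erase_add_one (by simp [hv, hr])]
      exact Finset.card_filter_add_card_filter_not _
    have hpos : ∀ v ∈ S, 0 < (S.filter (fun u => ¬ A v u)).card := by
      intro v hv
      obtain ⟨w, hw, hvw⟩ := hcone v hv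
      exact Finset.card_pos.2 ⟨w, by simp [hw, hvw]⟩
    obtain ⟨v, hv, hgood⟩ : ∃ v ∈ S, CP A c (N v) → CP A (c + 1) S := by
      by_cases hall : ∀ v ∈ S, CP A c (N v)
      · refine ⟨v0, hv0, fun _ => ⟨?_, ?_⟩⟩
        · have h1 := hcardN v0 hv0
          have h2 := hpos v0 hv0
          have h3 := (hall v0 hv0).1
          omega
        · intro v hv
          have h1 := hcardN v hv
          have h2 := hpos v hv
          have h3 := (hall v hv).1
          have h4 : (S.filter (fun u => ¬ A v u)).card = 1 := by omega
          obtain ⟨w, hw⟩ := Finset.card_eq_one.1 h4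
          have hw' : w ∈ S.filter (fun u => ¬ A v u) := by rw [hw]; simp
          refine ⟨w, (Finset.mem_filter.1 hw').1, (Finset.mem_filter.1 hw').2, ?_⟩
          intro u hu hvu
          have : u ∈ S.filter (fun u => ¬ A v u) := by simp [hu, hvu]
          rw [hw] at this; simpa using this
      · push Not at hall
        obtain ⟨v, hv, hn⟩ := hall
        exact ⟨v, hv, fun h => absurd h hn⟩
    obtain ⟨σ', hσ'⟩ := ih (N v) (by
      have h1 := hcardN v hv
      have h2 := hpos v hv
      omega)
    refine ⟨insert v σ', fun f hf hbd h0 => ?_⟩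
    refine cyc_step hr hs hv (hN v) hf hbd ?_ ?_
    · intro g hg hbg hgf
      refine hσ' g hg hbg fun hcp => ?_
      by_cases hvσ : v ∈ σ'
      · by_contra hne
        have := (hg _ hne).1 hvσ
        rw [hN] at this
        exact this.2.2 rfl
      · exact hgf _ hvσ (h0 (hgood hcp))
    · intro g hg hbg
      have hc := Finset.card_erase_add_one hv
      obtain ⟨σ2, hσ2⟩ := ihS (S.erase v) (Finset.erase_ssubset hv) (by omega)
      refine hσ2 g hg hbg fun hcp => ?_
      have := hcp.1
      omega

theorem cp_cycle {A : V → V → Prop} (hr : ∀ i, A i i) (hs : ∀ i j, A i j → A j i) :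
    ∀ (c : ℕ) (S : Finset V), CP A c S → ∃ (z : Finset V → ℝ) (σ : Finset V),
      Sup A S c z ∧ bd z = 0 ∧ z σ ≠ 0 := by
  intro c
  induction c with
  | zero =>
    intro S hS
    refine ⟨fun σ => if σ = ∅ then 1 else 0, ∅, ?_, ?_, by simp⟩
    · intro σ hσ
      have : σ = ∅ := by by_contra h; simp [h] at hσ
      subst this
      simp
    · funext τ
      rw [bd_apply]
      refine Finset.sum_eq_zero fun u _ => ?_
      simp
  | succ c ih =>
    intro S hS
    obtain ⟨hcard, hnn⟩ := hS
    have hne : S.Nonempty := by rw [← Finset.card_pos]; omega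
    obtain ⟨v, hv⟩ := hne
    obtain ⟨w, hw, hvw, huniq⟩ := hnn v hv
    have hwv : w ≠ v := by rintro rfl; exact hvw (hr _)
    obtain ⟨v', hv', hwv', huniq'⟩ := hnn w hw
    have hv'v : v = v' := huniq' v hv (fun h => hvw (hs _ _ h))
    subst hv'v
    have hmem : ∀ u, u ∈ (S.erase v).erase w ↔ u ∈ S ∧ u ≠ v ∧ u ≠ w := by
      intro u; simp [Finset.mem_erase]; tauto
    have hAv : ∀ u ∈ (S.erase v).erase w, A v u ∧ u ∈ S := by
      intro u hu
      rw [hmem] at hu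
      exact ⟨by by_contra h; exact hu.2.2 (huniq u hu.1 h), hu.1⟩
    have hAw : ∀ u ∈ (S.erase v).erase w, A w u ∧ u ∈ S := by
      intro u hu
      rw [hmem] at hu
      exact ⟨by by_contra h; exact hu.2.1 (huniq' u hu.1 h), hu.1⟩
    have hCP : CP A c ((S.erase v).erase w) := by
      refine ⟨?_, ?_⟩
      · have h1 := Finset.card_erase_add_one hv
        have h2 := Finset.card_erase_add_one (Finset.mem_erase.2 ⟨hwv, hw⟩ : w ∈ S.erase v)
        omega
      · intro u hu
        obtain ⟨x, hx, hux, hxu⟩ := hnn u ((hmem u).1 hu).1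
        refine ⟨x, ?_, hux, fun y hy => hxu y ((hmem y).1 hy).1⟩
        rw [hmem]
        refine ⟨hx, ?_, ?_⟩
        · rintro rfl; exact hux (hs _ _ (hAv u hu).1)
        · rintro rfl; exact hux (hs _ _ (hAw u hu).1)
    obtain ⟨z, σ, hz, hbz, hzσ⟩ := ih _ hCP
    have hvσ : v ∉ σ := by
      intro h; have := (hz σ hzσ).1 h; rw [hmem] at this; exact this.2.1 rfl
    have hwσ : w ∉ σ := by
      intro h; have := (hz σ hzσ).1 h; rw [hmem] at this; exact this.2.2 rfl
    refine ⟨cn v z - cn w z, insert v σ, (hz.cn hr hs hAv hv).sub (hz.cn hr hs hAw hw), ?_, ?_⟩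
    · rw [map_sub]
      funext τ
      rw [Pi.sub_apply, bd_cn, bd_cn, hbz]
      simp [cn]
    · have : cn w z (insert v σ) = 0 := by simp [cn, hwσ, hwv]
      rw [Pi.sub_apply, this]
      simp [cn, Finset.erase_insert hvσ, sg_ne, hzσ]

end VRHom
end

open MeasureTheory Filter Finset Matrix
noncomputable section

section VRBetti
set_option linter.unusedSectionVars false
set_option linter.unusedSimpArgs false
variable {V : Type} [Fintype V] [DecidableEq V] [LinearOrder V]

def extC (K : Finset (Finset V)) (c : ℕ) : Chains K c ℝ →ₗ[ℝ] (Finset V → ℝ) where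
  toFun f σ := if h : σ ∈ K ∧ σ.card = c then f ⟨σ, h⟩ else 0
  map_add' f g := by
    funext σ; simp only [Pi.add_apply]; split_ifs <;> simp
  map_smul' r f := by
    funext σ; simp only [Pi.smul_apply, RingHom.id_apply]; split_ifs <;> simp

lemma extC_apply (K : Finset (Finset V)) (c : ℕ) (f : Chains K c ℝ) (σ : Finset V) :
    extC K c f σ = if h : σ ∈ K ∧ σ.card = c then f ⟨σ, h⟩ else 0 := rfl

lemma extC_mem (K : Finset (Finset V)) (c : ℕ) (f : Chains K c ℝ) (σ) :
    extC K c f σ.1 = f σ := by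
  rw [extC_apply, dif_pos σ.2]

lemma extC_sup {A : V → V → Prop} {K : Finset (Finset V)}
    (hK : ∀ s, s ∈ K ↔ ∀ i ∈ s, ∀ j ∈ s, A i j) (c : ℕ) (f : Chains K c ℝ) :
    Sup A univ c (extC K c f) := by
  intro σ hσ
  rw [extC_apply] at hσ
  split_ifs at hσ with h
  · exact ⟨Finset.subset_univ _, h.2, (hK σ).1 h.1⟩
  · exact absurd rfl hσ

lemma extC_restrict {A : V → V → Prop} {K : Finset (Finset V)}
    (hK : ∀ s, s ∈ K ↔ ∀ i ∈ s, ∀ j ∈ s, A i j) (c : ℕ) (F : Finset V → ℝ)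
    (hF : Sup A univ c F) : extC K c (fun σ => F σ.1) = F := by
  funext σ
  rw [extC_apply]
  split_ifs with h
  · rfl
  · by_contra hne
    obtain ⟨_, h2, h3⟩ := hF σ (fun h => hne h.symm)
    exact h ⟨(hK σ).2 h3, h2⟩

lemma boundary_extC {A : V → V → Prop} {K : Finset (Finset V)}
    (hK : ∀ s, s ∈ K ↔ ∀ i ∈ s, ∀ j ∈ s, A i j) (c : ℕ) (f : Chains K (c + 1) ℝ) :
    extC K c (chainBoundaryLin K c f) = bd (extC K (c + 1) f) := by
  funext τ
  rw [extC_apply, bd_apply]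
  split_ifs with h
  · change chainBoundary K c f ⟨τ, h⟩ = _
    unfold chainBoundary
    refine Finset.sum_congr rfl fun v _ => ?_
    by_cases hv : v ∈ τ
    · rw [dif_neg (by simp [hv])]; simp [hv]
    · by_cases hvK : insert v τ ∈ K
      · rw [dif_pos ⟨hv, hvK⟩, if_pos hv, extC_apply,
          dif_pos ⟨hvK, by rw [Finset.card_insert_of_notMem hv, h.2]⟩]
        simp [sg]
      · rw [dif_neg (by simp [hvK]), if_pos hv, extC_apply, dif_neg (by simp [hvK])]
        simp
  · symm
    refine Finset.sum_eq_zero fun v _ => ?_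
    split_ifs with hv
    · rfl
    · rw [extC_apply, dif_neg, mul_zero]
      rintro ⟨h1, h2⟩
      rw [Finset.card_insert_of_notMem hv] at h2
      refine h ⟨(hK τ).2 fun i hi j hj => (hK _).1 h1 i (by simp [hi]) j (by simp [hj]), by omega⟩

lemma mem_ker_iff {A : V → V → Prop} {K : Finset (Finset V)}
    (hK : ∀ s, s ∈ K ↔ ∀ i ∈ s, ∀ j ∈ s, A i j) (c : ℕ) (f : Chains K (c + 1) ℝ) :
    f ∈ LinearMap.ker (chainBoundaryLin K c) ↔ bd (extC K (c + 1) f) = 0 := by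
  rw [LinearMap.mem_ker, ← boundary_extC hK]
  constructor
  · intro h; rw [h, map_zero]
  · intro h
    funext τ
    rw [← extC_mem K c (chainBoundaryLin K c f) τ, h]; rfl

lemma finrank_quot_le {Z W : Type*} [AddCommGroup Z] [Module ℝ Z] [FiniteDimensional ℝ Z]
    [AddCommGroup W] [Module ℝ W] [FiniteDimensional ℝ W] (B : Submodule ℝ Z)
    (Φ : Z →ₗ[ℝ] W) (h : LinearMap.ker Φ ≤ B) :
    Module.finrank ℝ (Z ⧸ B) ≤ Module.finrank ℝ W := by
  have h1 := Submodule.finrank_quotient_add_finrank B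
  have h2 := LinearMap.finrank_range_add_finrank_ker Φ
  have h3 := Submodule.finrank_mono h
  have h4 := Submodule.finrank_le (LinearMap.range Φ)
  omega

lemma le_finrank_quot {Z W : Type*} [AddCommGroup Z] [Module ℝ Z] [FiniteDimensional ℝ Z]
    [AddCommGroup W] [Module ℝ W] [FiniteDimensional ℝ W] (B : Submodule ℝ Z)
    (Φ : Z →ₗ[ℝ] W) (h : B ≤ LinearMap.ker Φ) (hs : Function.Surjective Φ) :
    Module.finrank ℝ W ≤ Module.finrank ℝ (Z ⧸ B) := by
  have h1 := Submodule.finrank_quotient_add_finrank B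
  have h2 := LinearMap.finrank_range_add_finrank_ker Φ
  have h3 := Submodule.finrank_mono h
  rw [LinearMap.range_eq_top.2 hs, finrank_top] at h2
  omega

lemma betti_le {A : V → V → Prop} {K : Finset (Finset V)}
    (hK : ∀ s, s ∈ K ↔ ∀ i ∈ s, ∀ j ∈ s, A i j) (k : ℕ) (P : Finset (Finset V))
    (h : ∀ F : Finset V → ℝ, Sup A univ (k + 1) F → bd F = 0 → (∀ σ ∈ P, F σ = 0) →
      ∃ e, Sup A univ (k + 1 + 1) e ∧ bd e = F) : bettiNumber K k ≤ P.card := by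
  unfold bettiNumber
  let Φ : ↥(LinearMap.ker (chainBoundaryLin K k)) →ₗ[ℝ] (P → ℝ) :=
    (LinearMap.pi fun σ : P => (LinearMap.proj σ.1 : (Finset V → ℝ) →ₗ[ℝ] ℝ)) ∘ₗ
      extC K (k + 1) ∘ₗ (LinearMap.ker (chainBoundaryLin K k)).subtype
  refine (finrank_quot_le _ Φ ?_).trans (by simp)
  intro f hf
  rw [LinearMap.mem_ker] at hf
  obtain ⟨e, he, hbe⟩ := h (extC K (k + 1) f.1) (extC_sup hK _ _) ((mem_ker_iff hK _ _).1 f.2)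
    (fun σ hσ => congrFun hf ⟨σ, hσ⟩)
  refine ⟨fun σ => e σ.1, ?_⟩
  funext τ
  rw [← extC_mem K (k + 1) (chainBoundaryLin K (k + 1) (fun σ => e σ.1)) τ, boundary_extC hK, extC_restrict hK _ _ he, hbe, extC_mem]
  rfl

lemma le_betti {A : V → V → Prop} {K : Finset (Finset V)}
    (hK : ∀ s, s ∈ K ↔ ∀ i ∈ s, ∀ j ∈ s, A i j) (k : ℕ) {ι : Type} [Fintype ι] [DecidableEq ι]
    (z : ι → Finset V → ℝ) (σ : ι → Finset V) (hz : ∀ i, Sup A univ (k + 1) (z i))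
    (hbz : ∀ i, bd (z i) = 0) (hne : ∀ i, z i (σ i) ≠ 0) (h0 : ∀ i j, i ≠ j → z i (σ j) = 0)
    (hbd : ∀ e, Sup A univ (k + 1 + 1) e → ∀ i, bd e (σ i) = 0) :
    Fintype.card ι ≤ bettiNumber K k := by
  unfold bettiNumber
  let Φ : ↥(LinearMap.ker (chainBoundaryLin K k)) →ₗ[ℝ] (ι → ℝ) :=
    (LinearMap.pi fun i : ι => (LinearMap.proj (σ i) : (Finset V → ℝ) →ₗ[ℝ] ℝ)) ∘ₗ
      extC K (k + 1) ∘ₗ (LinearMap.ker (chainBoundaryLin K k)).subtype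
  have hΦ : ∀ f i, Φ f i = extC K (k + 1) f.1 (σ i) := fun f i => rfl
  have := le_finrank_quot ((LinearMap.range (chainBoundaryLin K (k + 1))).comap
        (LinearMap.ker (chainBoundaryLin K k)).subtype) Φ ?_ ?_
  · simpa using this
  · intro f hf
    obtain ⟨e, he⟩ := hf
    rw [LinearMap.mem_ker]
    funext i
    rw [hΦ]
    have he' : chainBoundaryLin K (k + 1) e = f.1 := he
    rw [← he', boundary_extC hK]
    exact hbd _ (extC_sup hK _ _) i
  · let w : ι → ↥(LinearMap.ker (chainBoundaryLin K k)) := fun i =>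
      ⟨fun τ => z i τ.1, by rw [mem_ker_iff hK, extC_restrict hK _ _ (hz i), hbz]⟩
    have hw : ∀ i j, Φ (w i) j = z i (σ j) := by
      intro i j
      rw [hΦ]
      change extC K (k + 1) (fun τ => z i τ.1) (σ j) = _
      rw [extC_restrict hK _ _ (hz i)]
    intro c
    refine ⟨∑ i, (c i / z i (σ i)) • w i, ?_⟩
    funext j
    rw [map_sum, Finset.sum_apply, Finset.sum_eq_single j]
    · rw [map_smul, Pi.smul_apply, hw, smul_eq_mul, div_mul_cancel₀ _ (hne j)]
    · intro i _ hij
      rw [map_smul, Pi.smul_apply, hw, h0 i j hij, smul_zero]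
    · simp

end VRBetti
end

open MeasureTheory Filter Finset Matrix
noncomputable section

section VRCount
set_option linter.unusedSectionVars false
set_option linter.unusedSimpArgs false
variable {V : Type} [Fintype V] [DecidableEq V] [LinearOrder V]

lemma cp_clique_le {A : V → V → Prop} (hs : ∀ i j, A i j → A j i) {c : ℕ} {S Q : Finset V}
    (hS : CP A c S) (hQS : Q ⊆ S) (hQ : ∀ i ∈ Q, ∀ j ∈ Q, A i j) : Q.card ≤ c := by
  obtain ⟨hc, hnn⟩ := hS
  choose! w hw hw1 hw2 using hnn
  have h1 : Q.card ≤ (S \ Q).card := by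
    refine Finset.card_le_card_of_injOn w ?_ ?_
    · intro u hu
      have hu' : u ∈ Q := hu
      simp only [Finset.coe_sdiff, Set.mem_sdiff, Finset.mem_coe]
      refine ⟨hw u (hQS hu'), fun h => hw1 u (hQS hu') (hQ u hu' _ h)⟩
    · intro u hu u' hu' huu
      have hu : u ∈ S := hQS hu
      have hu' : u' ∈ S := hQS hu'
      have e1 := hw2 (w u) (hw u hu) u hu (fun h => hw1 u hu (hs _ _ h))
      have e2 := hw2 (w u) (hw u hu) u' hu' (fun h => hw1 u' hu' (hs _ _ (huu ▸ h)))
      rw [e1, ← e2]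
  have h2 := Finset.card_sdiff_add_card_eq_card hQS
  omega

lemma cp_common {A : V → V → Prop} (hs : ∀ i j, A i j → A j i) {c : ℕ}
    {S : Finset V} (hc : 2 ≤ c)
    (hS : CP A c S) {x y : V} (hx : x ∈ S) (hy : y ∈ S) (hxy : ¬ A x y) :
    ∃ z ∈ S, A x z ∧ A z y := by
  obtain ⟨hcard, hnn⟩ := hS
  have : ∃ z ∈ S, z ∉ ({x, y} : Finset V) := by
    refine Finset.exists_mem_notMem_of_card_lt_card ?_
    have := Finset.card_le_two (a := x) (b := y)
    omega
  obtain ⟨z, hz, hzxy⟩ := this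
  simp at hzxy
  refine ⟨z, hz, ?_, ?_⟩
  · by_contra h
    obtain ⟨w, hw, hw1, hw2⟩ := hnn x hx
    exact hzxy.2 ((hw2 z hz h).trans (hw2 y hy hxy).symm)
  · by_contra h
    obtain ⟨w, hw, hw1, hw2⟩ := hnn y hy
    exact hzxy.1 ((hw2 z hz (fun h' => h (hs _ _ h'))).trans
      (hw2 x hx (fun h' => hxy (hs _ _ h'))).symm)

open Classical in
/-- connected component -/
def vcomp (A : V → V → Prop) (v : V) : Finset V := univ.filter (fun u => Relation.ReflTransGen A v u)

lemma mem_comp {A : V → V → Prop} {u v : V} :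
    u ∈ vcomp A v ↔ Relation.ReflTransGen A v u := by simp [vcomp]

lemma comp_eq {A : V → V → Prop} (hs : ∀ i j, A i j → A j i) {u v : V} (h : u ∈ vcomp A v) :
    vcomp A u = vcomp A v := by
  rw [mem_comp] at h
  have : Std.Symm A := ⟨hs⟩
  have h' : Relation.ReflTransGen A u v := Std.Symm.symm _ _ h
  ext x
  rw [mem_comp, mem_comp]
  exact ⟨fun hx => h.trans hx, fun hx => h'.trans hx⟩

lemma exists_out {A : V → V → Prop} {T : Finset V} {v : V} (hv : v ∈ T)
    (hcard : T.card < (vcomp A v).card) : ∃ x ∈ T, ∃ y, y ∉ T ∧ A x y := by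
  by_contra hcon
  push Not at hcon
  obtain ⟨u, hu, huT⟩ := Finset.exists_mem_notMem_of_card_lt_card hcard
  rw [mem_comp] at hu
  apply huT
  clear huT
  induction hu with
  | refl => exact hv
  | tail _ hbc ih => by_contra h; exact hcon _ ih _ h hbc

lemma grow {X : Type*} [PseudoMetricSpace X] (pts : V → X) (r : ℝ) (hr : 0 ≤ r)
    (σ : Finset V) (v : V) (hv : v ∈ σ)
    (hσ : ∀ i ∈ σ, ∀ j ∈ σ, dist (pts i) (pts j) ≤ r) (j : ℕ)
    (hc : σ.card + j ≤ (vcomp (fun i j => dist (pts i) (pts j) ≤ r) v).card) :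
    ∃ T, σ ⊆ T ∧ T.card = σ.card + j ∧ ∀ x ∈ T, ∀ y ∈ T, dist (pts x) (pts y) ≤ (1 + j) * r := by
  induction j with
  | zero => exact ⟨σ, subset_rfl, by simp, by simpa using hσ⟩
  | succ j ih =>
    obtain ⟨T, hT, hTc, hTd⟩ := ih (by omega)
    obtain ⟨x, hx, y, hy, hxy⟩ := exists_out (A := fun i j => dist (pts i) (pts j) ≤ r) (hT hv) (by omega)
    have key : ∀ z ∈ T, dist (pts z) (pts y) ≤ (1 + (j + 1 : ℕ)) * r := by
      intro z hz
      have h1 := dist_triangle (pts z) (pts x) (pts y)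
      have h2 := hTd z hz x hx
      have h3 : dist (pts x) (pts y) ≤ r := hxy
      push_cast
      linarith
    refine ⟨insert y T, hT.trans (Finset.subset_insert _ _), ?_, ?_⟩
    · rw [Finset.card_insert_of_notMem hy]; omega
    · intro a ha b hb
      rw [Finset.mem_insert] at ha hb
      rcases ha with rfl | ha
      · rcases hb with rfl | hb
        · rw [dist_self]; positivity
        · rw [dist_comm]; exact key b hb
      · rcases hb with rfl | hb
        · exact key a ha
        · refine (hTd a ha b hb).trans ?_
          push_cast; linarith

lemma comp_cycles {A : V → V → Prop} (hr : ∀ i, A i i) (hs : ∀ i j, A i j → A j i)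
    (k : ℕ) (hk : 1 ≤ k) (σ : Finset V → Finset V)
    (hσ : ∀ S : Finset V, S.card ≤ 2 * (k + 1) → ∀ f : Finset V → ℝ,
      Sup A S (k + 1) f → bd f = 0 → (CP A (k + 1) S → f (σ S) = 0) →
        ∃ e, Sup A S (k + 1 + 1) e ∧ bd e = f)
    (F : Finset V → ℝ) (hF : Sup A univ (k + 1) F) (hbF : bd F = 0)
    (h1 : ∀ τ : Finset V, τ.card = k + 1 → (∀ i ∈ τ, ∀ j ∈ τ, A i j) →
      (∃ v ∈ τ, 2 * k + 3 ≤ (vcomp A v).card) → F τ = 0)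
    (h2 : ∀ S, CP A (k + 1) S → F (σ S) = 0) :
    ∃ e, Sup A univ (k + 1 + 1) e ∧ bd e = F := by
  classical
  set FS : Finset V → Finset V → ℝ := fun S τ => if τ ⊆ S then F τ else 0 with hFS
  set 𝒞 : Finset (Finset V) := univ.image (vcomp A) with h𝒞
  have hsub : ∀ τ : Finset V, (∀ i ∈ τ, ∀ j ∈ τ, A i j) → ∀ v ∈ τ, τ ⊆ vcomp A v := by
    intro τ hτ v hv u hu
    rw [mem_comp]; exact Relation.ReflTransGen.single (hτ v hv u hu)
  have huniq : ∀ S ∈ 𝒞, ∀ v ∈ S, S = vcomp A v := by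
    intro S hS v hv
    obtain ⟨w, _, rfl⟩ := Finset.mem_image.1 hS
    exact (comp_eq hs hv).symm
  have hne : ∀ τ, F τ ≠ 0 → τ.Nonempty := by
    intro τ hτ
    rw [← Finset.card_pos, (hF τ hτ).2.1]; omega
  have hsum : F = ∑ S ∈ 𝒞, FS S := by
    funext τ
    rw [Finset.sum_apply]
    by_cases h0 : F τ = 0
    · rw [h0]; symm; refine Finset.sum_eq_zero fun S _ => ?_; simp [hFS, h0]
    · obtain ⟨v, hv⟩ := hne τ h0
      rw [Finset.sum_eq_single (vcomp A v)]
      · simp [hFS, hsub τ (hF τ h0).2.2 v hv]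
      · intro S hS hSne
        simp only [hFS]
        rw [if_neg]
        intro hτS
        exact hSne (huniq S hS v (hτS hv))
      · intro h; exact absurd (Finset.mem_image_of_mem _ (Finset.mem_univ v)) h
  have hex : ∀ S ∈ 𝒞, ∃ e, Sup A univ (k + 1 + 1) e ∧ bd e = FS S := by
    intro S hS
    by_cases hbig : 2 * k + 3 ≤ S.card
    · refine ⟨0, Sup.zero, ?_⟩
      rw [map_zero]
      funext τ
      simp only [hFS, Pi.zero_apply]
      split_ifs with hτS
      · by_contra hne0
        have hne1 : F τ ≠ 0 := fun h => hne0 h.symm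
        obtain ⟨v, hv⟩ := hne τ hne1
        refine hne1 (h1 τ (hF τ hne1).2.1 (hF τ hne1).2.2 ⟨v, hv, ?_⟩)
        rw [← huniq S hS v (hτS hv)]; exact hbig
      · rfl
    · suffices hh : ∃ e, Sup A S (k + 1 + 1) e ∧ bd e = FS S by
        obtain ⟨e, he, hbe⟩ := hh
        exact ⟨e, he.mono (Finset.subset_univ _), hbe⟩
      refine hσ S (by omega) (FS S) ?_ ?_ ?_
      · intro τ hτ
        simp only [hFS] at hτ
        split_ifs at hτ with hτS
        · exact ⟨hτS, (hF τ hτ).2⟩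
        · exact absurd rfl hτ
      · funext τ
        by_cases hτS : τ ⊆ S
        · rcases τ.eq_empty_or_nonempty with rfl | ⟨v, hv⟩
          · rw [bd_apply]
            refine Finset.sum_eq_zero fun u _ => ?_
            have : F (insert u ∅) = 0 := by
              by_contra h
              have := (hF _ h).2.1
              simp at this; omega
            rw [if_pos (Finset.notMem_empty u)]
            simp only [hFS, this, ite_self, mul_zero]
          · rw [← hbF, bd_apply, bd_apply]
            refine Finset.sum_congr rfl fun u _ => ?_
            by_cases hu : insert u τ ⊆ S
            · simp [hFS, hu]
            · have : F (insert u τ) = 0 := by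
                by_contra h
                have h3 := hsub _ (hF _ h).2.2 v (by simp [hv])
                rw [← huniq S hS v (hτS hv)] at h3
                exact hu h3
              simp [hFS, hu, this]
        · rw [bd_apply]
          refine Finset.sum_eq_zero fun u _ => ?_
          have : ¬ insert u τ ⊆ S := fun h => hτS ((Finset.subset_insert _ _).trans h)
          simp [hFS, this]
      · intro hcp
        simp [hFS, h2 S hcp]
  choose! e he hbe using hex
  refine ⟨∑ S ∈ 𝒞, e S, ?_, ?_⟩
  · intro τ hτ
    rw [Finset.sum_apply] at hτ
    obtain ⟨S, hS, hS0⟩ := Finset.exists_ne_zero_of_sum_ne_zero hτ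
    exact he S hS τ hS0
  · rw [map_sum, hsum]
    exact Finset.sum_congr rfl hbe

open Classical in
def cpSets {X : Type*} [PseudoMetricSpace X] (pts : V → X) (r : ℝ) (c : ℕ) :
    Finset (Finset V) :=
  univ.filter (fun S => CP (fun i j => dist (pts i) (pts j) ≤ r) c S)

open Classical in
def closeSets {X : Type*} [PseudoMetricSpace X] (pts : V → X) (R : ℝ) (m : ℕ) :
    Finset (Finset V) :=
  univ.filter (fun T => T.card = m ∧ ∀ i ∈ T, ∀ j ∈ T, dist (pts i) (pts j) ≤ R)

lemma card_le_close {X : Type*} [PseudoMetricSpace X] (pts : V → X) (R : ℝ) (m : ℕ)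
    (P : Finset (Finset V)) (h : ∀ σ ∈ P, ∃ T ∈ closeSets pts R m, σ ⊆ T) :
    P.card ≤ 2 ^ m * (closeSets pts R m).card := by
  have h1 : P ⊆ (closeSets pts R m).biUnion Finset.powerset := by
    intro σ hσ
    obtain ⟨T, hT, hs⟩ := h σ hσ
    exact Finset.mem_biUnion.2 ⟨T, hT, Finset.mem_powerset.2 hs⟩
  refine (Finset.card_le_card h1).trans ?_
  rw [mul_comm]
  refine Finset.card_biUnion_le_card_mul _ _ _ fun T hT => ?_
  rw [Finset.card_powerset]
  simp only [closeSets, Finset.mem_filter] at hT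
  rw [hT.2.1]

lemma betti_upper {X : Type*} [PseudoMetricSpace X] (pts : V → X) (r : ℝ) (hr : 0 ≤ r)
    (K : Finset (Finset V)) (hK : ∀ s, s ∈ K ↔ ∀ i ∈ s, ∀ j ∈ s, dist (pts i) (pts j) ≤ r)
    (k : ℕ) (hk : 1 ≤ k) :
    bettiNumber K k ≤ (cpSets pts r (k + 1)).card +
      2 ^ (2 * k + 3) * (closeSets pts ((k + 3) * r) (2 * k + 3)).card := by
  classical
  set A : V → V → Prop := fun i j => dist (pts i) (pts j) ≤ r with hA
  have hrefl : ∀ i, A i i := fun i => by simpa [hA] using hr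
  have hsymm : ∀ i j, A i j → A j i := fun i j h => by simpa [hA, dist_comm] using h
  choose! σ hσ using cyc_bd hrefl hsymm (k + 1)
  set P1 : Finset (Finset V) := univ.filter (fun τ => τ.card = k + 1 ∧
    (∀ i ∈ τ, ∀ j ∈ τ, A i j) ∧ (∃ v ∈ τ, 2 * k + 3 ≤ (vcomp A v).card)) with hP1
  have h1 : bettiNumber K k ≤ ((cpSets pts r (k + 1)).image σ ∪ P1).card := by
    refine betti_le (A := A) hK k _ fun F hF hbF h0 => ?_
    refine comp_cycles hrefl hsymm k hk σ hσ F hF hbF ?_ ?_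
    · intro τ h1 h2 h3
      exact h0 τ (Finset.mem_union_right _ (by simp only [hP1, Finset.mem_filter]; simp [h1]; exact ⟨h2, h3⟩))
    · intro S hS
      refine h0 _ (Finset.mem_union_left _ (Finset.mem_image_of_mem _ ?_))
      simp only [cpSets, Finset.mem_filter, Finset.mem_univ, true_and]; exact hS
  refine h1.trans ((Finset.card_union_le _ _).trans (add_le_add Finset.card_image_le ?_))
  refine card_le_close _ _ _ _ fun τ hτ => ?_
  simp only [hP1, Finset.mem_filter, Finset.mem_univ, true_and] at hτ
  obtain ⟨h1, h2, v, hv, h3⟩ := hτ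
  obtain ⟨T, hT, hTc, hTd⟩ := grow pts r hr τ v hv h2 (k + 2) (by rw [h1]; exact le_trans (by omega) h3)
  refine ⟨T, ?_, hT⟩
  simp only [closeSets, Finset.mem_filter, Finset.mem_univ, true_and]
  refine ⟨by omega, fun i hi j hj => (hTd i hi j hj).trans (le_of_eq ?_)⟩
  push_cast; ring

lemma betti_lower {X : Type*} [PseudoMetricSpace X] (pts : V → X) (r : ℝ) (hr : 0 ≤ r)
    (K : Finset (Finset V)) (hK : ∀ s, s ∈ K ↔ ∀ i ∈ s, ∀ j ∈ s, dist (pts i) (pts j) ≤ r)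
    (k : ℕ) (hk : 1 ≤ k) :
    (cpSets pts r (k + 1)).card ≤ bettiNumber K k +
      2 ^ (2 * k + 3) * (closeSets pts ((k + 3) * r) (2 * k + 3)).card := by
  classical
  set A : V → V → Prop := fun i j => dist (pts i) (pts j) ≤ r with hA
  have hrefl : ∀ i, A i i := fun i => by simpa [hA] using hr
  have hsymm : ∀ i j, A i j → A j i := fun i j h => by simpa [hA, dist_comm] using h
  set iso : Finset V → Prop := fun S => ∀ x ∈ S, ∀ y, y ∉ S → ¬ A x y with hiso
  rw [← Finset.card_filter_add_card_filter_not (s := cpSets pts r (k + 1)) iso]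
  have hcpm : ∀ S ∈ cpSets pts r (k + 1), CP A (k + 1) S := by
    intro S hS
    simp only [cpSets, Finset.mem_filter, Finset.mem_univ, true_and] at hS; exact hS
  refine add_le_add ?_ ?_
  · set I := (cpSets pts r (k + 1)).filter iso with hI
    have hI1 : ∀ S : I, CP A (k + 1) S.1 := fun S => hcpm _ (Finset.mem_filter.1 S.2).1
    have hI2 : ∀ S : I, iso S.1 := fun S => (Finset.mem_filter.1 S.2).2
    choose z σ hz hbz hzσ using fun S : I => cp_cycle hrefl hsymm (k + 1) S.1 (hI1 S)
    have hσ := fun S : I => hz S (σ S) (hzσ S)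
    have hσne : ∀ S : I, (σ S).Nonempty := by
      intro S; rw [← Finset.card_pos, (hσ S).2.1]; omega
    rw [← Fintype.card_coe]
    refine le_betti (A := A) hK k z σ (fun S => (hz S).mono (Finset.subset_univ _)) hbz hzσ ?_ ?_
    · intro S S' hne
      by_contra h
      have hsub := (hz S _ h).1
      obtain ⟨x, hx⟩ := hσne S'
      have hxS := hsub hx
      have hxS' := (hσ S').1 hx
      have hadj : ∀ a ∈ S.1, ∀ b, A a b → b ∈ S.1 := by
        intro a ha b hab; by_contra hb; exact hI2 S a ha b hb hab
      have hSS : S'.1 ⊆ S.1 := by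
        intro y hy
        by_cases hxy : A x y
        · exact hadj x hxS y hxy
        · obtain ⟨w, _, hw1, hw2⟩ := cp_common hsymm (by omega) (hI1 S') hxS' hy hxy
          exact hadj w (hadj x hxS w hw1) y hw2
      have := Finset.eq_of_subset_of_card_le hSS (by rw [(hI1 S).1, (hI1 S').1])
      exact hne (Subtype.ext this.symm)
    · intro e he S
      rw [bd_apply]
      refine Finset.sum_eq_zero fun v _ => ?_
      by_cases hv : v ∈ σ S
      · simp [hv]
      · have : e (insert v (σ S)) = 0 := by
          by_contra h
          obtain ⟨_, h2, h3⟩ := he _ h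
          obtain ⟨x, hx⟩ := hσne S
          have hvS : v ∈ S.1 := by
            by_contra hvS
            exact hI2 S x ((hσ S).1 hx) v hvS (h3 x (by simp [hx]) v (by simp))
          have := cp_clique_le hsymm (hI1 S) (Finset.insert_subset hvS (hσ S).1) h3
          omega
        simp [this]
  · refine card_le_close _ _ _ _ fun S hS => ?_
    obtain ⟨h1, h2⟩ := Finset.mem_filter.1 hS
    have hcp := hcpm S h1
    simp only [hiso] at h2
    push Not at h2
    obtain ⟨x, hx, y, hy, hxy⟩ := h2
    have hxy' : dist (pts x) (pts y) ≤ r := hxy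
    have hd2 : ∀ i ∈ S, ∀ j ∈ S, dist (pts i) (pts j) ≤ 2 * r := by
      intro i hi j hj
      by_cases hij : A i j
      · have : dist (pts i) (pts j) ≤ r := hij
        linarith
      · obtain ⟨w, _, hw1, hw2⟩ := cp_common hsymm (by omega) hcp hi hj hij
        have h3 : dist (pts i) (pts w) ≤ r := hw1
        have h4 : dist (pts w) (pts j) ≤ r := hw2
        have := dist_triangle (pts i) (pts w) (pts j)
        linarith
    have h3r : 3 * r ≤ (k + 3) * r := by
      have : (0 : ℝ) ≤ k * r := by positivity
      linarith
    have key : ∀ i ∈ S, dist (pts i) (pts y) ≤ (k + 3) * r := by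
      intro i hi
      have := dist_triangle (pts i) (pts x) (pts y)
      have := hd2 i hi x hx
      linarith
    refine ⟨insert y S, ?_, Finset.subset_insert _ _⟩
    simp only [closeSets, Finset.mem_filter, Finset.mem_univ, true_and]
    refine ⟨by rw [Finset.card_insert_of_notMem hy, hcp.1]; ring, ?_⟩
    intro a ha b hb
    rw [Finset.mem_insert] at ha hb
    rcases ha with rfl | ha
    · rcases hb with rfl | hb
      · rw [dist_self]; positivity
      · rw [dist_comm]; exact key b hb
    · rcases hb with rfl | hb
      · exact key a ha
      · have := hd2 a ha b hb
        linarith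

end VRCount
end

open MeasureTheory Filter Finset Matrix
noncomputable section

section VRAnalysis
abbrev Ed (d : ℕ) : Type := EuclideanSpace ℝ (Fin d)

lemma tendsto_L1_translate {d : ℕ} (f : Ed d → ℝ) (hf : Integrable f) :
    Tendsto (fun t : Ed d => ∫ x, |f (x + t) - f x|) (nhds 0) (nhds 0) := by
  let g : Ed d → C(Ed d, Ed d) := fun t => ⟨fun x => x + t, by fun_prop⟩
  have hg : Continuous g := by
    refine ContinuousMap.continuous_of_continuous_uncurry _ ?_
    change Continuous fun p : Ed d × Ed d => p.2 + p.1
    fun_prop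
  have hgm : ∀ t, MeasurePreserving (g t) (volume : Measure (Ed d)) volume :=
    fun t => measurePreserving_add_right volume t
  have hf1 : MemLp f 1 (volume : Measure (Ed d)) := memLp_one_iff_integrable.2 hf
  have key := (tendsto_const_nhds (x := hf1.toLp f) (f := nhds (0 : Ed d))).compMeasurePreservingLp
    (hg.tendsto 0) hgm (hgm 0) (by simp)
  have h2 := (key.sub (tendsto_const_nhds (x := hf1.toLp f))).norm
  have e0 : Lp.compMeasurePreserving (g 0) (hgm 0) (hf1.toLp f) = hf1.toLp f := by
    rw [Lp.toLp_compMeasurePreserving]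
    congr 1
    funext x; simp [g]
  rw [e0, sub_self, norm_zero] at h2
  refine h2.congr fun t => ?_
  rw [Lp.toLp_compMeasurePreserving, ← MemLp.toLp_sub, L1.norm_eq_integral_norm]
  refine integral_congr_ae ?_
  filter_upwards [MemLp.coeFn_toLp ((hf1.comp_measurePreserving (hgm t)).sub hf1)] with x hx
  rw [hx]; rfl

lemma prod_le_pow' {ι : Type*} (s : Finset ι) (b : ι → ℝ) (M : ℝ)
    (hb : ∀ i, 0 ≤ b i) (hb' : ∀ i, b i ≤ M) : ∏ i ∈ s, b i ≤ M ^ s.card := by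
  rw [← Finset.prod_const]
  exact Finset.prod_le_prod (fun i _ => hb i) (fun i _ => hb' i)

lemma prod_diff_le {ι : Type*} (s : Finset ι) (a b : ι → ℝ) (M : ℝ) (hM : 1 ≤ M)
    (ha : ∀ i, 0 ≤ a i) (ha' : ∀ i, a i ≤ M) (hb : ∀ i, 0 ≤ b i) (hb' : ∀ i, b i ≤ M) :
    |∏ i ∈ s, a i - ∏ i ∈ s, b i| ≤ M ^ s.card * ∑ i ∈ s, |a i - b i| := by
  classical
  induction s using Finset.induction_on with
  | empty => simp
  | insert j s hj ih =>
    rw [Finset.prod_insert hj, Finset.prod_insert hj, Finset.sum_insert hj,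
      Finset.card_insert_of_notMem hj]
    have e : a j * ∏ i ∈ s, a i - b j * ∏ i ∈ s, b i =
      a j * (∏ i ∈ s, a i - ∏ i ∈ s, b i) + (a j - b j) * ∏ i ∈ s, b i := by ring
    have hpb : ∏ i ∈ s, b i ≤ M ^ s.card := prod_le_pow' s b M hb hb'
    have hpb0 : 0 ≤ ∏ i ∈ s, b i := Finset.prod_nonneg fun i _ => hb i
    have hM0 : 0 ≤ M ^ s.card := by positivity
    rw [e]
    calc _ ≤ |a j * (∏ i ∈ s, a i - ∏ i ∈ s, b i)| + |(a j - b j) * ∏ i ∈ s, b i| := abs_add_le _ _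
      _ ≤ M * (M ^ s.card * ∑ i ∈ s, |a i - b i|) + |a j - b j| * M ^ s.card := by
        rw [abs_mul, abs_mul, abs_of_nonneg (ha j), abs_of_nonneg hpb0]
        gcongr
        exact ha' j
      _ ≤ M * (M ^ s.card * ∑ i ∈ s, |a i - b i|) + M * (|a j - b j| * M ^ s.card) := by
        have : 0 ≤ |a j - b j| * M ^ s.card := by positivity
        nlinarith
      _ = _ := by ring

lemma tendsto_corr {d m : ℕ} (f : Ed d → ℝ) (hfm : Measurable f) (hf : Integrable f)
    (hf0 : ∀ x, 0 ≤ f x)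
    (M : ℝ) (hM : 1 ≤ M) (hfM : ∀ x, f x ≤ M) (u : Fin m → Ed d) (s : ℕ → ℝ)
    (hs : Tendsto s atTop (nhds 0)) :
    Tendsto (fun n => ∫ x, f x * ∏ i, f (x + s n • u i)) atTop
      (nhds (∫ x, f x * ∏ _i : Fin m, f x)) := by
  have hint : ∀ t : Fin m → Ed d, Integrable (fun x => f x * ∏ i, f (x + t i)) := by
    intro t
    refine hf.mul_bdd (c := M ^ m) ?_ ?_
    · refine Measurable.aestronglyMeasurable ?_
      exact Finset.measurable_prod _ fun i _ => hfm.comp (measurable_id.add_const _)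
    · refine Filter.Eventually.of_forall fun x => ?_
      rw [Real.norm_of_nonneg (Finset.prod_nonneg fun i _ => hf0 _)]
      exact (prod_le_pow' _ _ M (fun i => hf0 _) (fun i => hfM _)).trans (by simp)
  have hint2 : ∀ t : Ed d, Integrable (fun x => |f (x + t) - f x|) := by
    intro t
    exact ((hf.comp_add_right t).sub hf).abs
  rw [tendsto_iff_norm_sub_tendsto_zero]
  have hb : Tendsto (fun n => M * M ^ m * ∑ i, ∫ x, |f (x + s n • u i) - f x|) atTop (nhds 0) := by
    have : Tendsto (fun n => M * M ^ m * ∑ i, ∫ x, |f (x + s n • u i) - f x|) atTop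
        (nhds (M * M ^ m * ∑ _i : Fin m, 0)) := by
      refine Tendsto.const_mul _ (tendsto_finsetSum _ fun i _ => ?_)
      refine (tendsto_L1_translate f hf).comp ?_
      simpa using hs.smul_const (u i)
    simpa using this
  refine squeeze_zero (fun _ => norm_nonneg _) (fun n => ?_) hb
  have h0 := hint (fun _ => 0)
  simp only [add_zero] at h0
  rw [← integral_sub (hint _) h0, ← integral_finsetSum _ (fun i _ => hint2 _),
    ← integral_const_mul]
  refine (norm_integral_le_integral_norm _).trans ?_
  refine integral_mono_of_nonneg (Filter.Eventually.of_forall fun x => norm_nonneg _)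
    ((integrable_finsetSum _ fun i _ => hint2 _).const_mul _)
    (Filter.Eventually.of_forall fun x => ?_)
  have := prod_diff_le univ (fun i => f (x + s n • u i)) (fun _ => f x) M hM
    (fun i => hf0 _) (fun i => hfM _) (fun i => hf0 _) (fun i => hfM _)
  simp only [Finset.card_univ, Fintype.card_fin] at this
  dsimp only
  rw [← mul_sub, norm_mul, Real.norm_of_nonneg (hf0 x), mul_assoc]
  exact mul_le_mul (hfM x) this (norm_nonneg _) (by linarith)

lemma pi_density {d m : ℕ} (f : Ed d → ℝ) (hfm : Measurable f) (hf : Integrable f)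
    (hf0 : ∀ x, 0 ≤ f x) (ν : Measure (Ed d)) [IsProbabilityMeasure ν]
    (hν : ν = volume.withDensity (fun x => ENNReal.ofReal (f x))) :
    Measure.pi (fun _ : Fin m => ν) =
      (volume : Measure (Fin m → Ed d)).withDensity (fun y => ENNReal.ofReal (∏ i, f (y i))) := by
  refine Measure.pi_eq fun s hs => ?_
  have hms : MeasurableSet (Set.univ.pi s) := MeasurableSet.univ_pi hs
  rw [withDensity_apply _ hms, volume_pi, Measure.restrict_pi_pi,
    ← ofReal_integral_eq_lintegral_ofReal]
  · rw [integral_fintype_prod_eq_prod (fun _ => f), ENNReal.ofReal_prod_of_nonneg]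
    · refine Finset.prod_congr rfl fun i _ => ?_
      rw [hν, withDensity_apply _ (hs i), ofReal_integral_eq_lintegral_ofReal hf.restrict
        (Filter.Eventually.of_forall hf0)]
    · intro i _; exact integral_nonneg hf0
  · exact Integrable.fintype_prod fun i => hf.restrict
  · exact Filter.Eventually.of_forall fun y => Finset.prod_nonneg fun i _ => hf0 _

lemma integral_pi_density {d m : ℕ} (f : Ed d → ℝ) (hfm : Measurable f) (hf : Integrable f)
    (hf0 : ∀ x, 0 ≤ f x) (ν : Measure (Ed d)) [IsProbabilityMeasure ν]
    (hν : ν = volume.withDensity (fun x => ENNReal.ofReal (f x))) (G : (Fin m → Ed d) → ℝ) :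
    ∫ y, G y ∂(Measure.pi (fun _ : Fin m => ν)) = ∫ y, (∏ i, f (y i)) * G y := by
  rw [pi_density f hfm hf hf0 ν hν, integral_withDensity_eq_integral_toReal_smul]
  · refine integral_congr_ae (Filter.Eventually.of_forall fun y => ?_)
    dsimp only
    rw [ENNReal.toReal_ofReal (Finset.prod_nonneg fun i _ => hf0 _), smul_eq_mul]
  · exact (Finset.measurable_prod _ fun i _ => hfm.comp (measurable_pi_apply i)).ennreal_ofReal
  · simp

lemma integral_scale {d m : ℕ} (x : Ed d) (r : ℝ) (hr : 0 < r) (G : (Fin m → Ed d) → ℝ) :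
    ∫ y, G y = r ^ (d * m) * ∫ u : Fin m → Ed d, G (fun i => x + r • u i) := by
  have h1 := Measure.integral_comp_smul_of_nonneg (volume : Measure (Fin m → Ed d))
    (fun y => G (fun i => x + y i)) r (hR := hr.le)
  have h2 := integral_add_left_eq_self (μ := (volume : Measure (Fin m → Ed d))) G (fun _ => x)
  have h3 : Module.finrank ℝ (Fin m → Ed d) = d * m := by
    simp [Module.finrank_pi_fintype, mul_comm]
  rw [h3] at h1
  change ∫ u : Fin m → Ed d, G (fun i => x + r • u i) = _ at h1
  change ∫ y : Fin m → Ed d, G (fun i => x + y i) = _ at h2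
  rw [h1, h2, smul_eq_mul, ← mul_assoc, mul_inv_cancel₀ (by positivity), one_mul]

lemma meas_factor {V : Type} [Fintype V] {d : ℕ} {β : Type*} [MeasurableSpace β] (r : ℝ)
    (Ψ : (V → V → Prop) → β) :
    Measurable (fun pts : V → Ed d => Ψ (fun i j => dist (pts i) (pts j) ≤ r)) := by
  have h1 : Measurable (fun pts : V → Ed d => (fun i j => dist (pts i) (pts j) ≤ r : V → V → Prop)) := by
    refine measurable_pi_lambda _ fun i => measurable_pi_lambda _ fun j => ?_
    refine measurable_to_prop ?_
    refine (measurableSet_le (f := fun pts : V → Ed d => dist (pts i) (pts j)) (g := fun _ => r)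
      ?_ measurable_const).congr ?_
    · exact (measurable_pi_apply i).dist (measurable_pi_apply j)
    · ext; simp
  exact (Measurable.of_discrete (f := Ψ)).comp h1

lemma map_pi_emb {d n m : ℕ} (ν : Measure (Ed d)) [IsProbabilityMeasure ν] (e : Fin m ↪ Fin n) :
    MeasurePreserving (fun pts : Fin n → Ed d => fun i => pts (e i))
      (Measure.pi fun _ => ν) (Measure.pi fun _ => ν) := by
  have hm : Measurable (fun pts : Fin n → Ed d => fun i => pts (e i)) :=
    measurable_pi_lambda _ fun i => measurable_pi_apply _
  refine ⟨hm, ?_⟩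
  symm
  refine Measure.pi_eq fun s hs => ?_
  rw [Measure.map_apply hm (MeasurableSet.univ_pi hs)]
  have : (fun pts : Fin n → Ed d => fun i => pts (e i)) ⁻¹' (Set.univ.pi s) =
      Set.univ.pi (fun j => ⋂ (i : Fin m) (_ : e i = j), s i) := by
    ext p; simp
    constructor
    · rintro h j i rfl; exact h i
    · intro h i; exact h _ i rfl
  rw [this, Measure.pi_pi]
  have h2 : ∏ j ∈ univ.map e, ν (⋂ (i : Fin m) (_ : e i = j), s i) = ∏ i, ν (s i) := by
    rw [Finset.prod_map]
    refine Finset.prod_congr rfl fun i _ => ?_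
    congr 1
    ext x; simp
  rw [← h2]
  symm
  refine Finset.prod_subset (Finset.subset_univ _) fun j _ hj => ?_
  have : (⋂ (i : Fin m) (_ : e i = j), s i) = Set.univ := by
    ext x; simp
    intro i hi
    exact absurd (Finset.mem_map.2 ⟨i, Finset.mem_univ _, hi⟩) hj
  rw [this, measure_univ]

end VRAnalysis
end

open MeasureTheory Filter Finset Matrix
noncomputable section

section VRLimit

open Classical in
def cpInd {d m : ℕ} (c : ℕ) (r : ℝ) (p : Fin m → Ed d) : ℝ :=
  if CP (fun i j => dist (p i) (p j) ≤ r) c univ then 1 else 0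

lemma cpInd_meas {d m : ℕ} (c : ℕ) (r : ℝ) :
    Measurable (cpInd c r : (Fin m → Ed d) → ℝ) := by
  classical
  exact meas_factor r (fun A => if CP A c univ then (1 : ℝ) else 0)

lemma cpInd_nonneg {d m : ℕ} (c : ℕ) (r : ℝ) (p : Fin m → Ed d) : 0 ≤ cpInd c r p := by
  unfold cpInd; split_ifs <;> simp

lemma cpInd_le {d m : ℕ} (c : ℕ) (r : ℝ) (p : Fin m → Ed d) : cpInd c r p ≤ 1 := by
  unfold cpInd; split_ifs <;> simp

lemma cpInd_scale {d m : ℕ} (c : ℕ) (r : ℝ) (hr : 0 < r) (x : Ed d) (u : Fin m → Ed d) :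
    cpInd c r (Fin.cons x (fun i => x + r • u i) : Fin (m + 1) → Ed d) =
      cpInd c 1 (Fin.cons 0 u : Fin (m + 1) → Ed d) := by
  have h : (Fin.cons x (fun i => x + r • u i) : Fin (m + 1) → Ed d) =
      fun i => x + r • (Fin.cons 0 u : Fin (m + 1) → Ed d) i := by
    funext i
    refine Fin.cases ?_ (fun j => ?_) i <;> simp
  rw [h]
  unfold cpInd
  have : (fun i j => dist (x + r • (Fin.cons 0 u : Fin (m + 1) → Ed d) i)
      (x + r • (Fin.cons 0 u : Fin (m + 1) → Ed d) j) ≤ r) =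
      fun i j => dist ((Fin.cons 0 u : Fin (m + 1) → Ed d) i)
        ((Fin.cons 0 u : Fin (m + 1) → Ed d) j) ≤ 1 := by
    funext i j
    rw [dist_add_left, dist_smul₀, Real.norm_of_nonneg hr.le]
    exact propext (mul_le_iff_le_one_right hr)
  rw [this]

lemma cpInd_supp {d m : ℕ} (c : ℕ) (hc : 2 ≤ c) (u : Fin m → Ed d)
    (h : cpInd c 1 (Fin.cons 0 u : Fin (m + 1) → Ed d) ≠ 0) : u ∈ Metric.closedBall 0 2 := by
  unfold cpInd at h
  split_ifs at h with hcp
  · rw [mem_closedBall_zero_iff, pi_norm_le_iff_of_nonneg (by norm_num)]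
    intro i
    have hd : dist ((Fin.cons 0 u : Fin (m + 1) → Ed d) 0)
        ((Fin.cons 0 u : Fin (m + 1) → Ed d) i.succ) ≤ 2 := by
      by_cases hA : dist ((Fin.cons 0 u : Fin (m + 1) → Ed d) 0)
        ((Fin.cons 0 u : Fin (m + 1) → Ed d) i.succ) ≤ 1
      · linarith
      · obtain ⟨z, _, h1, h2⟩ := cp_common (fun i j h => by rwa [dist_comm]) hc hcp
          (Finset.mem_univ 0) (Finset.mem_univ i.succ) hA
        have := dist_triangle ((Fin.cons 0 u : Fin (m + 1) → Ed d) 0)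
          ((Fin.cons 0 u : Fin (m + 1) → Ed d) z) ((Fin.cons 0 u : Fin (m + 1) → Ed d) i.succ)
        linarith
    simpa using hd
  · exact absurd rfl h

lemma cons_meas {d m : ℕ} : Measurable (fun u : Fin m → Ed d => (Fin.cons 0 u : Fin (m + 1) → Ed d)) := by
  refine measurable_pi_lambda _ fun i => ?_
  refine Fin.cases ?_ (fun j => ?_) i
  · simp
  · simpa using measurable_pi_apply j

lemma hInd_meas {d m : ℕ} (c : ℕ) :
    Measurable (fun u : Fin m → Ed d => cpInd c 1 (Fin.cons 0 u : Fin (m + 1) → Ed d)) :=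
  (cpInd_meas c 1).comp cons_meas

lemma hInd_int {d m : ℕ} (c : ℕ) (hc : 2 ≤ c) :
    Integrable (fun u : Fin m → Ed d => cpInd c 1 (Fin.cons 0 u : Fin (m + 1) → Ed d)) := by
  have h1 : Integrable (Set.indicator (Metric.closedBall (0 : Fin m → Ed d) 2) (fun _ => (1 : ℝ))) := by
    rw [integrable_indicator_iff measurableSet_closedBall]
    exact integrableOn_const measure_closedBall_lt_top.ne
  refine h1.mono' (hInd_meas c).aestronglyMeasurable (Filter.Eventually.of_forall fun u => ?_)
  rw [Real.norm_of_nonneg (cpInd_nonneg _ _ _)]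
  by_cases h : cpInd c 1 (Fin.cons 0 u : Fin (m + 1) → Ed d) = 0
  · rw [h]; exact Set.indicator_nonneg (fun _ _ => zero_le_one) _
  · rw [Set.indicator_of_mem (cpInd_supp c hc u h)]; exact cpInd_le _ _ _

lemma integral_pi_succ {d m : ℕ} (ν : Measure (Ed d)) [IsProbabilityMeasure ν]
    (G : (Fin (m + 1) → Ed d) → ℝ) (hG : Measurable G) (C : ℝ) (hC : ∀ p, |G p| ≤ C) :
    ∫ p, G p ∂(Measure.pi fun _ => ν) =
      ∫ x, ∫ y, G (Fin.cons x y) ∂(Measure.pi fun _ : Fin m => ν) ∂ν := by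
  have h := (measurePreserving_piFinSuccAbove (fun _ : Fin (m + 1) => ν) 0).symm
  rw [← h.integral_comp']
  have hi : Integrable (fun p : Ed d × (Fin m → Ed d) => G (Fin.cons p.1 p.2))
      (ν.prod (Measure.pi fun _ : Fin m => ν)) := by
    refine Integrable.of_bound (C := C) ?_ (Filter.Eventually.of_forall fun p => hC _)
    refine Measurable.aestronglyMeasurable (hG.comp ?_)
    refine measurable_pi_lambda _ fun i => ?_
    refine Fin.cases ?_ (fun j => ?_) i
    · simpa using measurable_fst
    · change Measurable fun c : Ed d × (Fin m → Ed d) => c.2 j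
      exact (measurable_pi_apply j).comp measurable_snd
  rw [← integral_prod _ hi]
  refine integral_congr_ae (Filter.Eventually.of_forall fun p => ?_)
  simp [MeasurableEquiv.piFinSuccAbove_symm_apply, Fin.insertNthEquiv]

lemma cp_prob_limit {d m : ℕ} (c : ℕ) (hc : 2 ≤ c) (f : Ed d → ℝ) (hfm : Measurable f)
    (hf : Integrable f)
    (hf0 : ∀ x, 0 ≤ f x) (M : ℝ) (hM : 1 ≤ M) (hfM : ∀ x, f x ≤ M)
    (ν : Measure (Ed d)) [IsProbabilityMeasure ν]
    (hν : ν = volume.withDensity (fun x => ENNReal.ofReal (f x)))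
    (r : ℕ → ℝ) (hr : ∀ n, 0 < r n) (hr0 : Tendsto r atTop (nhds 0)) :
    Tendsto (fun n => (∫ p : Fin (m + 1) → Ed d, cpInd c (r n) p ∂(Measure.pi fun _ => ν)) /
        r n ^ (d * m)) atTop
      (nhds ((∫ u : Fin m → Ed d, cpInd c 1 (Fin.cons 0 u : Fin (m + 1) → Ed d)) *
        ∫ x, f x * ∏ _i : Fin m, f x)) := by
  have hνint : ∀ G : Ed d → ℝ, ∫ x, G x ∂ν = ∫ x, f x * G x := by
    intro G
    rw [hν, integral_withDensity_eq_integral_toReal_smul hfm.ennreal_ofReal (by simp)]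
    refine integral_congr_ae (Filter.Eventually.of_forall fun y => ?_)
    dsimp only
    rw [ENNReal.toReal_ofReal (hf0 _), smul_eq_mul]
  set h : (Fin m → Ed d) → ℝ := fun u => cpInd c 1 (Fin.cons 0 u : Fin (m + 1) → Ed d) with hh
  have hprod_bd : ∀ (x : Ed d) (t : Fin m → Ed d), ∏ i, f (x + t i) ≤ M ^ m := by
    intro x t
    exact (prod_le_pow' _ _ M (fun i => hf0 _) (fun i => hfM _)).trans (by simp)
  have hprod_nn : ∀ (x : Ed d) (t : Fin m → Ed d), 0 ≤ ∏ i, f (x + t i) := by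
    intro x t; exact Finset.prod_nonneg fun i _ => hf0 _
  have heq : ∀ n, (∫ p : Fin (m + 1) → Ed d, cpInd c (r n) p ∂(Measure.pi fun _ => ν)) /
      r n ^ (d * m) = ∫ u, h u * ∫ x, f x * ∏ i, f (x + r n • u i) := by
    intro n
    rw [integral_pi_succ ν _ (cpInd_meas c (r n)) 1 (fun p => by
      rw [abs_of_nonneg (cpInd_nonneg _ _ _)]; exact cpInd_le _ _ _)]
    have e1 : ∀ x, ∫ y, cpInd c (r n) (Fin.cons x y : Fin (m + 1) → Ed d)
        ∂(Measure.pi fun _ : Fin m => ν) =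
        r n ^ (d * m) * ∫ u, (∏ i, f (x + r n • u i)) * h u := by
      intro x
      rw [integral_pi_density f hfm hf hf0 ν hν, integral_scale x (r n) (hr n)]
      simp only [cpInd_scale c (r n) (hr n), hh]
    simp only [e1]
    rw [integral_const_mul, mul_div_cancel_left₀ _ (pow_pos (hr n) _).ne', integral_integral_swap]
    · refine integral_congr_ae (Filter.Eventually.of_forall fun u => ?_)
      dsimp only
      rw [integral_mul_const, hνint, mul_comm]
    · have hi : Integrable (fun p : Ed d × (Fin m → Ed d) => M ^ m * h p.2)
          (ν.prod (volume : Measure (Fin m → Ed d))) :=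
        ((hInd_int c hc).comp_snd ν).const_mul _
      refine hi.mono' ?_ (Filter.Eventually.of_forall fun p => ?_)
      · refine Measurable.aestronglyMeasurable ?_
        refine Measurable.mul ?_ ((hInd_meas c).comp measurable_snd)
        refine Finset.measurable_prod _ fun i _ => hfm.comp ?_
        exact measurable_fst.add (((measurable_pi_apply i).comp measurable_snd).const_smul (r n))
      · simp only [Function.uncurry]
        rw [Real.norm_of_nonneg (mul_nonneg (hprod_nn _ _) (cpInd_nonneg _ _ _))]
        exact mul_le_mul_of_nonneg_right (hprod_bd _ _) (cpInd_nonneg _ _ _)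
  simp only [heq]
  rw [← integral_mul_const]
  refine tendsto_integral_of_dominated_convergence (fun u => h u * M ^ m) ?_ ?_ ?_ ?_
  · intro n
    refine ((hInd_meas c).aestronglyMeasurable).mul ?_
    refine StronglyMeasurable.aestronglyMeasurable ?_
    refine StronglyMeasurable.integral_prod_right (f := fun (u : Fin m → Ed d) (x : Ed d) => f x * ∏ i, f (x + r n • u i)) ?_
    refine Measurable.stronglyMeasurable ?_
    refine (hfm.comp measurable_snd).mul ?_
    refine Finset.measurable_prod _ fun i _ => hfm.comp ?_
    exact measurable_snd.add (((measurable_pi_apply i).comp measurable_fst).const_smul (r n))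
  · exact (hInd_int c hc).mul_const _
  · intro n
    refine Filter.Eventually.of_forall fun u => ?_
    have h1 : 0 ≤ ∫ x, f x * ∏ i, f (x + r n • u i) :=
      integral_nonneg fun x => mul_nonneg (hf0 _) (hprod_nn _ _)
    rw [Real.norm_of_nonneg (mul_nonneg (cpInd_nonneg _ _ _) h1)]
    refine mul_le_mul_of_nonneg_left ?_ (cpInd_nonneg _ _ _)
    rw [← hνint]
    calc _ ≤ ∫ _x : Ed d, M ^ m ∂ν := by
          refine integral_mono_of_nonneg (Filter.Eventually.of_forall fun x => hprod_nn _ _)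
            (integrable_const _) (Filter.Eventually.of_forall fun x => hprod_bd _ _)
      _ = M ^ m := by simp
  · refine Filter.Eventually.of_forall fun u => ?_
    exact (tendsto_corr f hfm hf hf0 M hM hfM u r hr0).const_mul _

lemma f_pos {d m : ℕ} (f : Ed d → ℝ) (hfm : Measurable f)
    (hf : Integrable f)
    (hf0 : ∀ x, 0 ≤ f x) (M : ℝ) (hfM : ∀ x, f x ≤ M)
    (ν : Measure (Ed d)) [IsProbabilityMeasure ν]
    (hν : ν = volume.withDensity (fun x => ENNReal.ofReal (f x))) :
    0 < ∫ x, f x * ∏ _i : Fin m, f x := by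
  have hnn : ∀ x, 0 ≤ f x * ∏ _i : Fin m, f x := fun x =>
    mul_nonneg (hf0 _) (Finset.prod_nonneg fun i _ => hf0 _)
  have hi : Integrable (fun x => f x * ∏ _i : Fin m, f x) := by
    refine hf.mul_bdd (c := M ^ m) ?_ ?_
    · exact (Finset.measurable_prod _ fun i _ => hfm).aestronglyMeasurable
    · refine Filter.Eventually.of_forall fun x => ?_
      rw [Real.norm_of_nonneg (Finset.prod_nonneg fun i _ => hf0 _)]
      exact (prod_le_pow' _ _ M (fun i => hf0 _) (fun i => hfM _)).trans (by simp)
  rw [integral_pos_iff_support_of_nonneg hnn hi]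
  by_contra hcon
  have h0 : volume (Function.support (fun x => f x * ∏ _i : Fin m, f x)) = 0 := by
    simpa using hcon
  have hsupp : Function.support (fun x => f x * ∏ _i : Fin m, f x) = {x | f x ≠ 0} := by
    ext x; simp
    tauto
  rw [hsupp] at h0
  have h1 : ν Set.univ = 0 := by
    rw [hν, withDensity_apply _ MeasurableSet.univ, Measure.restrict_univ]
    rw [lintegral_eq_zero_iff hfm.ennreal_ofReal]
    have : ∀ᵐ x : Ed d, ¬ (f x ≠ 0) := by
      rw [ae_iff]; simpa using h0
    filter_upwards [this] with x hx
    simp at hx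
    simp [hx]
  simp at h1

end VRLimit
end

open MeasureTheory Filter Finset Matrix

noncomputable section

def avec {d : ℕ} (hd : 2 ≤ d) (j : ℕ) : Ed d :=
  WithLp.toLp 2 (fun i => if i = (⟨0, by omega⟩ : Fin d) then 1 else if i = (⟨1, by omega⟩ : Fin d) then (j : ℝ) else 0)

lemma avec_zero {d : ℕ} (hd : 2 ≤ d) (j : ℕ) : avec hd j (⟨0, by omega⟩ : Fin d) = 1 := by
  simp [avec]

lemma avec_one {d : ℕ} (hd : 2 ≤ d) (j : ℕ) : avec hd j (⟨1, by omega⟩ : Fin d) = j := by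
  simp [avec]

lemma avec_ne {d : ℕ} (hd : 2 ≤ d) (j : ℕ) : avec hd j ≠ 0 := by
  intro h
  have := avec_zero hd j
  rw [h] at this
  simp at this

def xvec {d : ℕ} (hd : 2 ≤ d) (j : ℕ) (b : Bool) : Ed d :=
  ((if b then 1 else -1) * ‖avec hd j‖⁻¹ : ℝ) • avec hd j

lemma xvec_norm {d : ℕ} (hd : 2 ≤ d) (j : ℕ) (b : Bool) : ‖xvec hd j b‖ = 1 := by
  have h := norm_ne_zero_iff.2 (avec_ne hd j)
  unfold xvec
  rw [norm_smul, norm_mul, norm_inv, norm_norm, mul_assoc, inv_mul_cancel₀ h]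
  cases b <;> simp

lemma xvec_neg {d : ℕ} (hd : 2 ≤ d) (j : ℕ) (b : Bool) : xvec hd j (!b) = - xvec hd j b := by
  cases b <;> simp [xvec]

lemma xvec_inj {d : ℕ} (hd : 2 ≤ d) {j j' : ℕ} {b b' : Bool} (h : xvec hd j b = xvec hd j' b') :
    j = j' ∧ b = b' := by
  have h0 := congrArg (fun v : Ed d => v (⟨0, by omega⟩ : Fin d)) h
  have h1 := congrArg (fun v : Ed d => v (⟨1, by omega⟩ : Fin d)) h
  simp only [xvec, PiLp.smul_apply, avec_zero, avec_one, smul_eq_mul, mul_one] at h0 h1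
  have hp := norm_pos_iff.2 (avec_ne hd j)
  have hp' := norm_pos_iff.2 (avec_ne hd j')
  have hne : ((if b then 1 else -1) * ‖avec hd j‖⁻¹ : ℝ) ≠ 0 := by
    have := inv_ne_zero hp.ne'
    cases b <;> simpa using hp.ne'
  rw [← h0] at h1
  have hj : (j : ℝ) = j' := mul_left_cancel₀ hne h1
  have hj' : j = j' := by exact_mod_cast hj
  refine ⟨hj', ?_⟩
  have hi := inv_pos.2 hp
  have hi' := inv_pos.2 hp'
  cases b <;> cases b' <;> first | rfl | (exfalso; simp at h0; linarith)

lemma xvec_dist {d : ℕ} (hd : 2 ≤ d) {j j' : ℕ} {b b' : Bool} (h : ¬ (j' = j ∧ b' = !b)) :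
    dist (xvec hd j b) (xvec hd j' b') < 2 := by
  have hne : xvec hd j b ≠ xvec hd j' (!b') := by
    intro he
    have := xvec_inj hd he
    apply h
    refine ⟨this.1.symm, ?_⟩
    rw [this.2]; simp
  have hn : ‖xvec hd j b‖ = ‖xvec hd j' (!b')‖ := by rw [xvec_norm, xvec_norm]
  have := norm_add_lt_of_not_sameRay ((not_sameRay_iff_of_norm_eq hn).2 hne)
  rw [xvec_norm, xvec_norm, xvec_neg] at this
  rw [dist_eq_norm, sub_eq_add_neg]
  linarith

lemma xvec_dist_eq {d : ℕ} (hd : 2 ≤ d) (j : ℕ) (b : Bool) :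
    dist (xvec hd j b) (xvec hd j (!b)) = 2 := by
  rw [xvec_neg, dist_eq_norm, sub_neg_eq_add, ← two_smul ℝ, norm_smul, xvec_norm]; norm_num

lemma config_exists {d : ℕ} (hd : 2 ≤ d) (k : ℕ) :
    ∃ (σ : Fin (2 * k + 1 + 1) → Fin (2 * k + 1 + 1)) (p : Fin (2 * k + 1 + 1) → Ed d),
      (∀ i, 1 < dist (p i) (p (σ i))) ∧ (∀ i j, j ≠ σ i → dist (p i) (p j) < 1) ∧ p 0 = 0 := by
  have hcard : Fintype.card (Fin (k + 1) × Bool) = 2 * k + 1 + 1 := by simp; ring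
  let e := Fintype.equivFinOfCardEq hcard
  let x : Fin (2 * k + 1 + 1) → Ed d := fun i => xvec hd (e.symm i).1 (e.symm i).2
  let σ : Fin (2 * k + 1 + 1) → Fin (2 * k + 1 + 1) := fun i => e ((e.symm i).1, !(e.symm i).2)
  have h1 : ∀ i, dist (x i) (x (σ i)) = 2 := by
    intro i
    simp only [x, σ, Equiv.symm_apply_apply]
    exact xvec_dist_eq _ _ _
  have h2 : ∀ i j, j ≠ σ i → dist (x i) (x j) < 2 := by
    intro i j hj
    refine xvec_dist hd ?_
    rintro ⟨ha, hb⟩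
    apply hj
    simp only [σ]
    rw [← hb, ← Fin.ext ha]
    simp
  have h3 : ∀ᶠ t in nhdsWithin (2 : ℝ) (Set.Iio 2), ∀ i j, j ≠ σ i → dist (x i) (x j) < t := by
    refine eventually_all.2 fun i => eventually_all.2 fun j => ?_
    by_cases hj : j ≠ σ i
    · filter_upwards [nhdsWithin_le_nhds (Ioi_mem_nhds (h2 i j hj))] with t ht _ using ht
    · exact Filter.Eventually.of_forall fun t h => absurd h hj
  have h4 : ∀ᶠ t in nhdsWithin (2 : ℝ) (Set.Iio 2), (0 : ℝ) < t :=
    nhdsWithin_le_nhds (Ioi_mem_nhds (by norm_num))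
  obtain ⟨t, ⟨ht, ht0⟩, ht2⟩ := ((h3.and h4).and self_mem_nhdsWithin).exists
  have ht2 : t < 2 := ht2
  have hdist : ∀ i j, dist (t⁻¹ • (x i - x 0)) (t⁻¹ • (x j - x 0)) = t⁻¹ * dist (x i) (x j) := by
    intro i j
    rw [dist_smul₀, dist_sub_right, Real.norm_of_nonneg (by positivity)]
  refine ⟨σ, fun i => t⁻¹ • (x i - x 0), ?_, ?_, by simp⟩
  · intro i
    rw [hdist, h1, inv_mul_eq_div, lt_div_iff₀ ht0]; linarith
  · intro i j hj
    rw [hdist, inv_mul_eq_div, div_lt_iff₀ ht0]; linarith [ht i j hj]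

lemma h_pos {d : ℕ} (hd : 2 ≤ d) (k : ℕ) (hk : 1 ≤ k) :
    0 < ∫ u : Fin (2 * k + 1) → Ed d,
      cpInd (k + 1) 1 (Fin.cons 0 u : Fin (2 * k + 1 + 1) → Ed d) := by
  obtain ⟨σ, p, h1, h2, h0⟩ := config_exists hd k
  rw [integral_pos_iff_support_of_nonneg (fun u => cpInd_nonneg _ _ _) (hInd_int _ (by omega))]
  refine Measure.measure_pos_of_mem_nhds (x := fun i => p i.succ) volume ?_
  have hp : (Fin.cons 0 (fun i => p i.succ) : Fin (2 * k + 1 + 1) → Ed d) = p := by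
    funext i
    refine Fin.cases ?_ (fun j => ?_) i
    · simp [h0]
    · simp
  have hc : ∀ i j, Continuous fun u : Fin (2 * k + 1) → Ed d =>
      dist ((Fin.cons 0 u : Fin (2 * k + 1 + 1) → Ed d) i)
        ((Fin.cons 0 u : Fin (2 * k + 1 + 1) → Ed d) j) := by
    have hc1 : ∀ i, Continuous fun u : Fin (2 * k + 1) → Ed d =>
      ((Fin.cons 0 u : Fin (2 * k + 1 + 1) → Ed d) i) := by
      intro i
      refine Fin.cases ?_ (fun j => ?_) i
      · simpa using continuous_const
      · simpa using continuous_apply j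
    exact fun i j => (hc1 i).dist (hc1 j)
  have e1 : ∀ᶠ u in nhds (fun i => p i.succ : Fin (2 * k + 1) → Ed d), ∀ i,
      1 < dist ((Fin.cons 0 u : Fin (2 * k + 1 + 1) → Ed d) i)
        ((Fin.cons 0 u : Fin (2 * k + 1 + 1) → Ed d) (σ i)) := by
    refine eventually_all.2 fun i => ?_
    refine (hc i (σ i)).continuousAt.eventually_const_lt ?_
    beta_reduce; rw [hp]; exact h1 i
  have e2 : ∀ᶠ u in nhds (fun i => p i.succ : Fin (2 * k + 1) → Ed d), ∀ i j, j ≠ σ i →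
      dist ((Fin.cons 0 u : Fin (2 * k + 1 + 1) → Ed d) i)
        ((Fin.cons 0 u : Fin (2 * k + 1 + 1) → Ed d) j) < 1 := by
    refine eventually_all.2 fun i => eventually_all.2 fun j => eventually_imp_distrib_left.2 fun hj => ?_
    refine (hc i j).continuousAt.eventually_lt_const ?_
    beta_reduce; rw [hp]; exact h2 i j hj
  filter_upwards [e1, e2] with u hu1 hu2
  have hcp : CP (fun i j => dist ((Fin.cons 0 u : Fin (2 * k + 1 + 1) → Ed d) i)
        ((Fin.cons 0 u : Fin (2 * k + 1 + 1) → Ed d) j) ≤ 1) (k + 1) univ := by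
    refine ⟨by simp; ring, fun v _ => ⟨σ v, mem_univ _, not_le.2 (hu1 v), fun w _ hw => ?_⟩⟩
    by_contra hne
    exact hw (hu2 v w hne).le
  rw [Function.mem_support, cpInd, if_pos hcp]
  norm_num

end

open MeasureTheory Filter Finset Matrix

noncomputable section

open Classical in
lemma expect_card {d n m : ℕ} (ν : Measure (Ed d)) [IsProbabilityMeasure ν]
    (F : (Fin n → Ed d) → Finset (Finset (Fin n))) (Q : (Fin m → Ed d) → ℝ) (hQ : Measurable Q)
    (C : ℝ) (hC : ∀ p, |Q p| ≤ C)
    (hF : ∀ pts S, S ∈ F pts → S.card = m)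
    (hS : ∀ pts S (h : S.card = m), (if S ∈ F pts then (1 : ℝ) else 0) =
      Q (fun i => pts (S.orderEmbOfFin h i))) :
    Integrable (fun pts => ((F pts).card : ℝ)) (Measure.pi fun _ : Fin n => ν) ∧
    ∫ pts, ((F pts).card : ℝ) ∂(Measure.pi fun _ : Fin n => ν) =
      (n.choose m : ℝ) * ∫ p, Q p ∂(Measure.pi fun _ : Fin m => ν) := by
  have h1 : ∀ pts, ((F pts).card : ℝ) =
      ∑ S ∈ (powersetCard m (univ : Finset (Fin n))).attach,
        Q (fun i => pts (S.1.orderEmbOfFin (mem_powersetCard.1 S.2).2 i)) := by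
    intro pts
    rw [Finset.sum_congr rfl fun S _ => (hS pts S.1 (mem_powersetCard.1 S.2).2).symm]
    rw [Finset.sum_attach (powersetCard m (univ : Finset (Fin n)))
      (fun S => if S ∈ F pts then (1 : ℝ) else 0)]
    rw [Finset.sum_boole]
    congr 2
    ext S
    simp only [mem_filter, mem_powersetCard, subset_univ, true_and]
    exact ⟨fun h => ⟨hF _ _ h, h⟩, fun h => h.2⟩
  have hmp : ∀ S : {S // S ∈ powersetCard m (univ : Finset (Fin n))},
      MeasurePreserving (fun pts : Fin n → Ed d => fun i =>
        pts (S.1.orderEmbOfFin (mem_powersetCard.1 S.2).2 i))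
      (Measure.pi fun _ => ν) (Measure.pi fun _ => ν) :=
    fun S => map_pi_emb ν (S.1.orderEmbOfFin (mem_powersetCard.1 S.2).2).toEmbedding
  have hi : ∀ S : {S // S ∈ powersetCard m (univ : Finset (Fin n))},
      Integrable (fun pts : Fin n → Ed d => Q (fun i =>
        pts (S.1.orderEmbOfFin (mem_powersetCard.1 S.2).2 i))) (Measure.pi fun _ => ν) := by
    intro S
    refine Integrable.of_bound (C := C) ?_ (Filter.Eventually.of_forall fun p => hC _)
    exact (hQ.comp (hmp S).measurable).aestronglyMeasurable
  simp_rw [h1]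
  refine ⟨integrable_finset_sum _ fun S _ => hi S, ?_⟩
  rw [integral_finset_sum _ fun S _ => hi S]
  have h2 : ∀ S : {S // S ∈ powersetCard m (univ : Finset (Fin n))},
      ∫ pts : Fin n → Ed d, Q (fun i =>
        pts (S.1.orderEmbOfFin (mem_powersetCard.1 S.2).2 i)) ∂(Measure.pi fun _ => ν) =
        ∫ p, Q p ∂(Measure.pi fun _ : Fin m => ν) := by
    intro S
    have := integral_map (μ := Measure.pi fun _ : Fin n => ν) (hmp S).measurable.aemeasurable
      (f := Q) hQ.aestronglyMeasurable
    rw [(hmp S).map_eq] at this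
    exact this.symm
  rw [Finset.sum_congr rfl fun S _ => h2 S]
  simp [card_powersetCard]

lemma orderEmb_image {n m : ℕ} (S : Finset (Fin n)) (h : S.card = m) (P : Fin n → Prop) :
    (∀ i ∈ S, P i) ↔ ∀ i, P (S.orderEmbOfFin h i) := by
  constructor
  · intro hP i; exact hP _ (orderEmbOfFin_mem S h i)
  · intro hP i hi
    have : i ∈ Set.range (S.orderEmbOfFin h) := by rw [range_orderEmbOfFin]; exact hi
    obtain ⟨j, rfl⟩ := this
    exact hP j

lemma CP_emb {n m : ℕ} (S : Finset (Fin n)) (h : S.card = m) (A : Fin n → Fin n → Prop) (c : ℕ) :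
    CP A c S ↔ CP (fun i j => A (S.orderEmbOfFin h i) (S.orderEmbOfFin h j)) c univ := by
  have hex : ∀ P : Fin n → Prop, (∃ i ∈ S, P i) ↔ ∃ i, P (S.orderEmbOfFin h i) := by
    intro P
    have := orderEmb_image S h (fun i => ¬ P i)
    rw [← not_iff_not]; push Not; exact this
  unfold CP
  rw [card_univ, Fintype.card_fin, h]
  refine and_congr Iff.rfl ?_
  rw [orderEmb_image S h]
  simp only [mem_univ, true_and, forall_true_left]
  refine forall_congr' fun v => ?_
  rw [hex]
  refine exists_congr fun w => and_congr Iff.rfl ?_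
  rw [orderEmb_image S h]
  simp only [EmbeddingLike.apply_eq_iff_eq]

lemma expect_cp {d n : ℕ} (ν : Measure (Ed d)) [IsProbabilityMeasure ν] (c m : ℕ) (hm : m = 2 * c) (r : ℝ) :
    Integrable (fun pts => ((cpSets pts r c).card : ℝ)) (Measure.pi fun _ : Fin n => ν) ∧
    ∫ pts, ((cpSets pts r c).card : ℝ) ∂(Measure.pi fun _ : Fin n => ν) =
      (n.choose m : ℝ) * ∫ p, cpInd c r p ∂(Measure.pi fun _ : Fin m => ν) := by
  classical
  refine expect_card ν (fun pts => cpSets pts r c) (cpInd c r) (cpInd_meas c r) 1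
    (fun p => by rw [abs_of_nonneg (cpInd_nonneg _ _ _)]; exact cpInd_le _ _ _) ?_ ?_
  · intro pts S hS
    simp only [cpSets, mem_filter] at hS
    rw [hS.2.1, hm]
  · intro pts S h
    simp only [cpSets, mem_filter, mem_univ, true_and, cpInd]
    rw [CP_emb S h]

open Classical in
def closeInd {d m : ℕ} (R : ℝ) (p : Fin m → Ed d) : ℝ :=
  if ∀ i j, dist (p i) (p j) ≤ R then 1 else 0

lemma closeInd_nonneg {d m : ℕ} (r : ℝ) (p : Fin m → Ed d) : 0 ≤ closeInd r p := by
  unfold closeInd; split_ifs <;> simp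

lemma closeInd_le {d m : ℕ} (r : ℝ) (p : Fin m → Ed d) : closeInd r p ≤ 1 := by
  unfold closeInd; split_ifs <;> simp

lemma closeInd_meas {d m : ℕ} (r : ℝ) :
    Measurable (closeInd r : (Fin m → Ed d) → ℝ) := by
  classical
  exact meas_factor r (fun A => if ∀ i j, A i j then (1 : ℝ) else 0)

lemma closeInd_abs {d m : ℕ} (r : ℝ) (p : Fin m → Ed d) : |closeInd r p| ≤ 1 := by
  rw [abs_of_nonneg (closeInd_nonneg _ _)]; exact closeInd_le _ _

lemma expect_close {d n : ℕ} (ν : Measure (Ed d)) [IsProbabilityMeasure ν] (m : ℕ) (R : ℝ) :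
    Integrable (fun pts => ((closeSets pts R m).card : ℝ)) (Measure.pi fun _ : Fin n => ν) ∧
    ∫ pts, ((closeSets pts R m).card : ℝ) ∂(Measure.pi fun _ : Fin n => ν) =
      (n.choose m : ℝ) * ∫ p, closeInd R p ∂(Measure.pi fun _ : Fin m => ν) := by
  classical
  refine expect_card ν (fun pts => closeSets pts R m) (closeInd R) (closeInd_meas R) 1
    (closeInd_abs R) ?_ ?_
  · intro pts S hS
    simp only [closeSets, mem_filter] at hS
    exact hS.2.1
  · intro pts S h
    simp only [closeSets, mem_filter, mem_univ, true_and, closeInd]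
    refine if_congr ?_ rfl rfl
    rw [orderEmb_image S h]
    simp only [h, true_and]
    refine forall_congr' fun i => ?_
    rw [orderEmb_image S h]

lemma close_bound {d m : ℕ} (ν : Measure (Ed d)) [IsProbabilityMeasure ν] (R B : ℝ)
    (hB : ∀ x, ν.real (Metric.closedBall x R) ≤ B) :
    ∫ p, closeInd R p ∂(Measure.pi fun _ : Fin (m + 1) => ν) ≤ B ^ m := by
  rw [integral_pi_succ ν _ (closeInd_meas R) 1 (closeInd_abs R)]
  have h1 : ∀ x : Ed d, ∫ y, closeInd R (Fin.cons x y : Fin (m + 1) → Ed d)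
      ∂(Measure.pi fun _ : Fin m => ν) ≤ B ^ m := by
    intro x
    have hms : MeasurableSet (Set.univ.pi fun _ : Fin m => Metric.closedBall x R) :=
      MeasurableSet.univ_pi fun _ => measurableSet_closedBall
    calc ∫ y, closeInd R (Fin.cons x y : Fin (m + 1) → Ed d) ∂(Measure.pi fun _ : Fin m => ν)
        ≤ ∫ y, Set.indicator (Set.univ.pi fun _ : Fin m => Metric.closedBall x R)
            (fun _ => (1 : ℝ)) y ∂(Measure.pi fun _ : Fin m => ν) := by
          refine integral_mono_of_nonneg (Filter.Eventually.of_forall fun y => closeInd_nonneg _ _)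
            ((integrable_const 1).indicator hms) (Filter.Eventually.of_forall fun y => ?_)
          dsimp only
          by_cases h : ∀ i j, dist ((Fin.cons x y : Fin (m + 1) → Ed d) i)
            ((Fin.cons x y : Fin (m + 1) → Ed d) j) ≤ R
          · have : y ∈ Set.univ.pi fun _ : Fin m => Metric.closedBall x R := by
              intro i _
              have := h i.succ 0
              simpa using this
            rw [Set.indicator_of_mem this]
            exact closeInd_le _ _
          · rw [closeInd, if_neg h]
            exact Set.indicator_nonneg (fun _ _ => zero_le_one) _
      _ = ∏ _i : Fin m, ν.real (Metric.closedBall x R) := by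
          rw [integral_indicator_const _ hms, smul_eq_mul, mul_one, measureReal_def, Measure.pi_pi,
            ENNReal.toReal_prod]
          rfl
      _ ≤ B ^ m := by
          rw [prod_const, card_univ, Fintype.card_fin]
          exact pow_le_pow_left₀ measureReal_nonneg (hB x) _
  calc _ ≤ ∫ _x, B ^ m ∂ν := by
        refine integral_mono_of_nonneg (Filter.Eventually.of_forall fun y =>
          integral_nonneg fun _ => closeInd_nonneg _ _)
          (integrable_const _) (Filter.Eventually.of_forall h1)
    _ = _ := by simp

lemma ball_bound {d : ℕ} (f : Ed d → ℝ) (M : ℝ) (hM : 1 ≤ M) (hfM : ∀ x, f x ≤ M)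
    (ν : Measure (Ed d)) [IsProbabilityMeasure ν]
    (hν : ν = volume.withDensity (fun x => ENNReal.ofReal (f x))) (x : Ed d) (R : ℝ) (hR : 0 ≤ R) :
    ν.real (Metric.closedBall x R) ≤ M * (R ^ d * (volume : Measure (Ed d)).real (Metric.ball 0 1)) := by
  have h1 : ν (Metric.closedBall x R) ≤ ENNReal.ofReal M * volume (Metric.closedBall x R) := by
    rw [hν, withDensity_apply _ measurableSet_closedBall]
    calc _ ≤ ∫⁻ _y in Metric.closedBall x R, ENNReal.ofReal M :=
          lintegral_mono fun y => ENNReal.ofReal_le_ofReal (hfM y)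
      _ = _ := by simp
  have h2 := ENNReal.toReal_mono (ENNReal.mul_ne_top ENNReal.ofReal_ne_top
    measure_closedBall_lt_top.ne) h1
  rw [ENNReal.toReal_mul, ENNReal.toReal_ofReal (by linarith)] at h2
  have h3 := Measure.addHaar_real_closedBall (volume : Measure (Ed d)) x hR
  rw [finrank_euclideanSpace, Fintype.card_fin] at h3
  rw [← h3]
  exact h2

end

open MeasureTheory Filter Finset Matrix

noncomputable section

lemma choose_lim (m : ℕ) :
    Tendsto (fun n : ℕ => (n.choose m : ℝ) / (n : ℝ) ^ m) atTop (nhds (1 / (m.factorial : ℝ))) := by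
  have h := (isEquivalent_choose m)
  have h2 : Tendsto (fun n : ℕ => ((n : ℝ) ^ m / (m.factorial : ℝ)) / (n : ℝ) ^ m) atTop
      (nhds (1 / (m.factorial : ℝ))) := by
    refine tendsto_const_nhds.congr' ?_
    filter_upwards [eventually_gt_atTop 0] with n hn
    have : (n : ℝ) ≠ 0 := by positivity
    field_simp
  exact (h.div (Asymptotics.IsEquivalent.refl (u := fun n : ℕ => (n : ℝ) ^ m))).symm.tendsto_nhds h2

lemma r_tendsto (d : ℕ) (hd : 2 ≤ d) (r : ℕ → ℝ) (hr : ∀ n : ℕ, 0 < r n)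
    (hsub : Tendsto (fun n : ℕ => (n : ℝ) * r n ^ d) atTop (nhds 0)) :
    Tendsto r atTop (nhds 0) := by
  have h1 : Tendsto (fun n => r n ^ d) atTop (nhds 0) := by
    refine squeeze_zero' (Filter.Eventually.of_forall fun n => (pow_pos (hr n) d).le) ?_ hsub
    filter_upwards [eventually_ge_atTop 1] with n hn
    have : (1 : ℝ) ≤ n := by exact_mod_cast hn
    exact le_mul_of_one_le_left (pow_pos (hr n) d).le this
  rw [Metric.tendsto_atTop] at h1 ⊢
  intro ε hε
  obtain ⟨N, hN⟩ := h1 (ε ^ d) (pow_pos hε d)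
  refine ⟨N, fun n hn => ?_⟩
  have := hN n hn
  rw [Real.dist_0_eq_abs, abs_of_pos (hr n)]
  rw [Real.dist_0_eq_abs, abs_of_pos (pow_pos (hr n) d)] at this
  exact lt_of_pow_lt_pow_left₀ d hε.le this

lemma betti_meas {n d k : ℕ} (r : ℝ) :
    Measurable (fun pts : Fin n → Ed d => (bettiNumber (VRcomplex n d pts r) k : ℝ)) := by
  classical
  have := meas_factor (V := Fin n) (d := d) r (fun A => (bettiNumber
    (Finset.univ.filter fun s : Finset (Fin n) => ∀ i ∈ s, ∀ j ∈ s, A i j) k : ℝ))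
  convert this using 4
  unfold VRcomplex
  congr

lemma betti_expect {d : ℕ} (n k : ℕ) (hk : 1 ≤ k) (ν : Measure (Ed d)) [IsProbabilityMeasure ν]
    (r : ℝ) (hr : 0 < r) (B : ℝ) (hB : ∀ x, ν.real (Metric.closedBall x ((k + 3) * r)) ≤ B) :
    |∫ pts : Fin n → Ed d, (bettiNumber (VRcomplex n d pts r) k : ℝ) ∂(Measure.pi fun _ => ν) -
      (n.choose (2 * k + 1 + 1) : ℝ) *
        ∫ p, cpInd (k + 1) r p ∂(Measure.pi fun _ : Fin (2 * k + 1 + 1) => ν)| ≤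
      2 ^ (2 * k + 3) * ((n.choose (2 * k + 3) : ℝ) * B ^ (2 * k + 2)) := by
  obtain ⟨i1, e1⟩ := expect_cp (n := n) ν (k + 1) (2 * k + 1 + 1) (by ring) r
  obtain ⟨i2, e2⟩ := expect_close (n := n) ν (2 * k + 3) ((k + 3) * r)
  have hK : ∀ (pts : Fin n → Ed d) (s), s ∈ VRcomplex n d pts r ↔
      ∀ i ∈ s, ∀ j ∈ s, dist (pts i) (pts j) ≤ r := by
    intro pts s; simp [VRcomplex]
  have hu : ∀ pts : Fin n → Ed d, (bettiNumber (VRcomplex n d pts r) k : ℝ) ≤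
      ((cpSets pts r (k + 1)).card : ℝ) +
      2 ^ (2 * k + 3) * ((closeSets pts ((k + 3) * r) (2 * k + 3)).card : ℝ) := by
    intro pts
    exact_mod_cast betti_upper pts r hr.le _ (hK pts) k hk
  have hl : ∀ pts : Fin n → Ed d, ((cpSets pts r (k + 1)).card : ℝ) ≤
      (bettiNumber (VRcomplex n d pts r) k : ℝ) +
      2 ^ (2 * k + 3) * ((closeSets pts ((k + 3) * r) (2 * k + 3)).card : ℝ) := by
    intro pts
    exact_mod_cast betti_lower pts r hr.le _ (hK pts) k hk
  have i3 : Integrable (fun pts : Fin n → Ed d => (bettiNumber (VRcomplex n d pts r) k : ℝ))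
      (Measure.pi fun _ => ν) := by
    refine (i1.add (i2.const_mul (2 ^ (2 * k + 3)))).mono' (betti_meas r).aestronglyMeasurable
      (Filter.Eventually.of_forall fun pts => ?_)
    rw [Real.norm_of_nonneg (by positivity)]
    exact hu pts
  have h4 := integral_mono i3 (i1.add (i2.const_mul (2 ^ (2 * k + 3)))) hu
  have h5 := integral_mono i1 (i3.add (i2.const_mul (2 ^ (2 * k + 3)))) hl
  rw [integral_add' i1 (i2.const_mul _), integral_const_mul, e1, e2] at h4
  rw [integral_add' i3 (i2.const_mul _), integral_const_mul, e1, e2] at h5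
  have h6 : 2 ^ (2 * k + 3) * ((n.choose (2 * k + 3) : ℝ) *
      ∫ p, closeInd ((k + 3) * r) p ∂(Measure.pi fun _ : Fin (2 * k + 3) => ν)) ≤
      2 ^ (2 * k + 3) * ((n.choose (2 * k + 3) : ℝ) * B ^ (2 * k + 2)) := by
    have := close_bound (m := 2 * k + 2) ν ((k + 3) * r) B hB
    gcongr
  rw [abs_le]
  constructor <;> linarith

/-- **Expected Betti numbers of random Vietoris–Rips complexes in the subcritical
regime** (Kahle). Fix `d ≥ 2` and `k ≥ 1`. Let `X₁, …, X_n` be i.i.d. points in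
`ℝ^d` with common distribution `ν` having a bounded measurable density `f`, and
let `r = r(n) > 0` satisfy `n·r^d → 0`. Then there is a constant `D_k > 0`
(depending on `k`, `d`, `f`) with
`E[β_k(VR(n,r))] / (n^{2k+2}·r^{d(2k+1)}) → D_k`. -/
theorem vietoris_rips_expected_betti (d k : ℕ) (hd : 2 ≤ d) (hk : 1 ≤ k)
    (ν : Measure (EuclideanSpace ℝ (Fin d))) [IsProbabilityMeasure ν]
    (f : EuclideanSpace ℝ (Fin d) → ℝ) (hf_meas : Measurable f)
    (hf_nonneg : ∀ x, 0 ≤ f x) (hf_bdd : ∃ M : ℝ, ∀ x, f x ≤ M)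
    (hν : ν = MeasureTheory.volume.withDensity (fun x => ENNReal.ofReal (f x)))
    (r : ℕ → ℝ) (hr : ∀ n : ℕ, 0 < r n)
    (hsub : Tendsto (fun n : ℕ => (n : ℝ) * r n ^ d) atTop (nhds 0)) :
    ∃ D : ℝ, 0 < D ∧
      Tendsto (fun n : ℕ =>
          (∫ pts : Fin n → EuclideanSpace ℝ (Fin d),
              (bettiNumber (VRcomplex n d pts (r n)) k : ℝ)
            ∂ Measure.pi (fun _ : Fin n => ν)) /
          ((n : ℝ) ^ (2 * k + 2) * r n ^ (d * (2 * k + 1))))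
        atTop (nhds D) := by
  obtain ⟨M0, hM0⟩ := hf_bdd
  obtain ⟨M, hM, hfM⟩ : ∃ M : ℝ, 1 ≤ M ∧ ∀ x, f x ≤ M :=
    ⟨max M0 1, le_max_right _ _, fun x => (hM0 x).trans (le_max_left _ _)⟩
  have hf : Integrable f := by
    refine ⟨hf_meas.aestronglyMeasurable, ?_⟩
    rw [hasFiniteIntegral_iff_ofReal (Filter.Eventually.of_forall hf_nonneg)]
    have h1 : ν Set.univ = 1 := measure_univ
    rw [hν, withDensity_apply _ MeasurableSet.univ, Measure.restrict_univ] at h1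
    rw [h1]; exact ENNReal.one_lt_top
  have hr0 := r_tendsto d hd r hr hsub
  have hlim := cp_prob_limit (m := 2 * k + 1) (k + 1) (by omega) f hf_meas hf hf_nonneg M hM hfM ν hν
    r hr hr0
  have hpos := mul_pos (h_pos hd k hk) (f_pos (m := 2 * k + 1) f hf_meas hf hf_nonneg M hfM ν hν)
  set L := (∫ u : Fin (2 * k + 1) → Ed d,
      cpInd (k + 1) 1 (Fin.cons 0 u : Fin (2 * k + 1 + 1) → Ed d)) *
        ∫ x, f x * ∏ _i : Fin (2 * k + 1), f x with hL
  refine ⟨1 / ((2 * k + 2).factorial : ℝ) * L, by positivity, ?_⟩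
  have hmain := (choose_lim (2 * k + 2)).mul hlim
  set v := (volume : Measure (Ed d)).real (Metric.ball 0 1) with hv
  set Kc : ℝ := 2 ^ (2 * k + 3) * (M * ((k + 3) ^ d * v)) ^ (2 * k + 2) with hKc
  have hv0 : 0 ≤ v := measureReal_nonneg
  have herr : Tendsto (fun n : ℕ =>
      ((∫ pts : Fin n → Ed d, (bettiNumber (VRcomplex n d pts (r n)) k : ℝ)
            ∂ Measure.pi (fun _ : Fin n => ν)) -
        (n.choose (2 * k + 1 + 1) : ℝ) *
        ∫ p, cpInd (k + 1) (r n) p ∂(Measure.pi fun _ : Fin (2 * k + 1 + 1) => ν)) /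
          ((n : ℝ) ^ (2 * k + 2) * r n ^ (d * (2 * k + 1)))) atTop (nhds 0) := by
    have hz : Tendsto (fun n : ℕ => Kc * ((n : ℝ) * r n ^ d)) atTop (nhds 0) := by
      simpa using hsub.const_mul Kc
    refine squeeze_zero_norm' ?_ hz
    filter_upwards [eventually_ge_atTop 1] with n hn
    have hn' : (0 : ℝ) < n := by exact_mod_cast hn
    have hrn := hr n
    have hb := betti_expect n k hk ν (r n) (hr n) _
      (fun x => ball_bound f M hM hfM ν hν x ((k + 3) * r n) (by positivity))
    rw [norm_div, Real.norm_eq_abs, Real.norm_of_nonneg (by positivity), div_le_iff₀ (by positivity)]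
    refine hb.trans ?_
    have hc : (n.choose (2 * k + 3) : ℝ) ≤ (n : ℝ) ^ (2 * k + 3) := by
      exact_mod_cast Nat.choose_le_pow n (2 * k + 3)
    calc _ ≤ 2 ^ (2 * k + 3) * ((n : ℝ) ^ (2 * k + 3) *
          (M * (((k + 3) * r n) ^ d * v)) ^ (2 * k + 2)) := by gcongr
      _ = _ := by
        rw [hKc]
        simp only [mul_pow, pow_mul]
        ring
  have hsum := hmain.add herr
  rw [add_zero] at hsum
  refine hsum.congr' ?_
  filter_upwards [eventually_ge_atTop 1] with n hn
  have hn' : (0 : ℝ) < n := by exact_mod_cast hn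
  have hrn := hr n
  rw [div_mul_div_comm, ← add_div]
  congr 1
  ring
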